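/- arXiv:2311.15482 — 7 statements merged into one kernel-verified Lean document; each statement's English description precedes it below -/
import Mathlib

section
/- Let p0, p1, p2, p3 ∈ ℝ³ be affinely independent points, let K be their convex hull, and for each of the four faces f of K (the convex hull of three of the points) let n_f ∈ ℝ³ be a unit normal vector to f. Define the normal-normal bubble space 𝔹_K = { b ∈ 𝕊 : n_fᵀ b n_f = 0 for all four faces f }. Let u : ℝ³ → ℝ^{3×3} be the matrix field u(x) = V + x × Σ with V ∈ 𝕋 and Σ ∈ 𝕊. Assume that: (a) for each of the six edges e = [p_i, p_j] (i < j) with unit tangent t = (p_j − p_i)/‖p_j − p_i‖, and for every m ∈ ℝ³ with m·t = 0, one has ∫_e mᵀ u(x) t dH¹(x) = 0; and (b) for every b ∈ 𝔹_K, ∫_K (curl u)(x) : b dx = 0, where : is the Frobenius inner product and the integral is with respect to Lebesgue measure on ℝ³. Then u = 0, i.e. V = 0 and Σ = 0. -/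
open MeasureTheory Matrix
open scoped RealInnerProductSpace

noncomputable section

/-- Euclidean 3-space. -/
abbrev E3 := EuclideanSpace ℝ (Fin 3)

/-- View a Euclidean vector as a plain function `Fin 3 → ℝ`. -/
def tov (x : E3) : Fin 3 → ℝ := x

/-- The Levi-Civita symbol on `Fin 3`. -/
def eps (i j k : Fin 3) : ℝ :=
  ((((j : ℤ) - (i : ℤ)) * ((k : ℤ) - (i : ℤ)) * ((k : ℤ) - (j : ℤ)) : ℤ) : ℝ) / 2

/-- Partial derivative in the `i`-th coordinate direction. -/
def pd (i : Fin 3) (f : E3 → ℝ) (x : E3) : ℝ := fderiv ℝ f x (EuclideanSpace.single i 1)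

/-- Row-wise curl of a matrix field: `(curl σ)_{ij} = ∑_{k,l} ε_{jkl} ∂_k σ_{il}`. -/
def mcurl (σ : E3 → Matrix (Fin 3) (Fin 3) ℝ) (x : E3) : Matrix (Fin 3) (Fin 3) ℝ :=
  Matrix.of fun i j => ∑ k, ∑ l, eps j k l * pd k (fun y => σ y i l) x

/-- `x × M`: the matrix whose `j`-th column is the cross product of `x` with the
`j`-th column of `M`. -/
def crossMat (x : E3) (M : Matrix (Fin 3) (Fin 3) ℝ) : Matrix (Fin 3) (Fin 3) ℝ :=
  Matrix.of fun i j => crossProduct (tov x) (fun r => M r j) i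

theorem pd_affine (c : ℝ) (a : Fin 3 → ℝ) (k : Fin 3) (x : E3) :
    pd k (fun y => c + ∑ r, a r * y r) x = a k := by
  have h : HasFDerivAt (fun y : E3 => c + ∑ r, a r * y r)
      (∑ r, a r • (EuclideanSpace.proj r : E3 →L[ℝ] ℝ)) x := by
    refine HasFDerivAt.const_add c (HasFDerivAt.fun_sum fun r _ => ?_)
    exact ((EuclideanSpace.proj r : E3 →L[ℝ] ℝ).hasFDerivAt).const_mul (a r)
  rw [pd, h.fderiv]
  simp

theorem mcurl_add_crossMat (V S : Matrix (Fin 3) (Fin 3) ℝ) (x : E3) :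
    mcurl (fun y => V + crossMat y S) x = S.trace • (1 : Matrix (Fin 3) (Fin 3) ℝ) - Sᵀ := by
  have h : ∀ i l k, pd k (fun y => (V + crossMat y S) i l) x =
      crossProduct (Pi.single k 1) (fun r => S r l) i := by
    intro i l k
    rw [← pd_affine (V i l) (fun k => crossProduct (Pi.single k 1) (fun r => S r l) i) k x]
    congr 1
    funext y
    fin_cases i <;>
      simp [crossMat, tov, cross_apply, Fin.sum_univ_three] <;> ring
  ext i j
  simp only [mcurl, of_apply, h]
  fin_cases i <;> fin_cases j <;>
    simp [eps, cross_apply, Fin.sum_univ_three, Matrix.trace] <;> ring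

/-- A function whose average under reflection in the midpoint of a segment is the constant `c`
integrates to zero over the segment only if `c = 0`. -/
theorem eq_zero_of_setIntegral_segment_eq_zero (a b : E3) (hab : a ≠ b) (f : E3 → ℝ)
    (hf : Continuous f) (c : ℝ) (hc : ∀ x, f x + f (a + b - x) = 2 * c)
    (h0 : ∫ x in segment ℝ a b, f x ∂μH[1] = 0) : c = 0 := by
  have hfin : μH[1] (segment ℝ a b) = edist a b := hausdorffMeasure_segment a b
  have hlt : μH[1] (segment ℝ a b) < ⊤ := by rw [hfin]; exact edist_lt_top a b
  have hcomp : IsCompact (segment ℝ a b) := by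
    rw [← convexHull_pair]; exact (Set.toFinite _).isCompact_convexHull ℝ
  have : IsFiniteMeasure (μH[1].restrict (segment ℝ a b)) := ⟨by simpa using hlt⟩
  have hg_int : ∀ g : E3 → ℝ, Continuous g → IntegrableOn g (segment ℝ a b) μH[1] := by
    intro g hg
    obtain ⟨C, hC⟩ := hcomp.exists_bound_of_continuousOn hg.continuousOn
    refine Integrable.of_bound hg.aestronglyMeasurable C ?_
    exact (ae_restrict_iff' hcomp.measurableSet).2 (Filter.Eventually.of_forall hC)
  let e : E3 ≃ᵢ E3 := IsometryEquiv.subLeft (a + b)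
  have hpre : e ⁻¹' (segment ℝ a b) = segment ℝ a b := by
    have key : ∀ x ∈ segment ℝ a b, a + b - x ∈ segment ℝ a b := by
      rintro x ⟨s, t, hs, ht, hst, rfl⟩
      refine ⟨t, s, ht, hs, by linarith, ?_⟩
      obtain rfl : t = 1 - s := by linarith
      module
    ext x
    refine ⟨fun hx => ?_, fun hx => key x hx⟩
    simpa [e] using key _ hx
  have hr : ∫ x in segment ℝ a b, f (a + b - x) ∂μH[1] = 0 := by
    have := (e.measurePreserving_hausdorffMeasure 1).setIntegral_preimage_emb
      e.toHomeomorph.measurableEmbedding f (segment ℝ a b)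
    rw [hpre, h0] at this
    exact this
  have hsum := integral_add (hg_int f hf) (hg_int (fun x => f (a + b - x)) (by fun_prop))
  rw [h0, hr] at hsum
  simp only [hc, integral_const, smul_eq_mul] at hsum
  have hpos : 0 < (μH[1] : Measure E3).real (segment ℝ a b) :=
    ENNReal.toReal_pos (by rw [hfin]; simpa using hab) hlt.ne
  simp only [measureReal_restrict_apply_univ] at hsum
  nlinarith

theorem volume_convexHull_range_pos (p : Fin 4 → E3) (hp : AffineIndependent ℝ p) :
    0 < (volume : Measure E3).real (convexHull ℝ (Set.range p)) := by
  refine ENNReal.toReal_pos ?_ ((Set.finite_range p).isCompact_convexHull ℝ).measure_lt_top.ne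
  have htop : affineSpan ℝ (Set.range p) = ⊤ :=
    hp.affineSpan_eq_top_iff_card_eq_finrank_add_one.2 (by simp)
  have hne : (interior (convexHull ℝ (Set.range p))).Nonempty :=
    interior_convexHull_nonempty_iff_affineSpan_eq_top.2 htop
  exact (Measure.measure_pos_of_nonempty_interior _ hne).ne'

theorem cross_mulVec_sub (S : Matrix (Fin 3) (Fin 3) ℝ) (a b : Fin 3 → ℝ) :
    crossProduct a (S *ᵥ b) - crossProduct b (S *ᵥ a) =
      (S.trace • (1 : Matrix (Fin 3) (Fin 3) ℝ) - Sᵀ) *ᵥ crossProduct a b := by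
  ext i
  fin_cases i <;>
    simp [cross_apply, Matrix.mulVec, dotProduct, Fin.sum_univ_three, Matrix.trace,
      Matrix.one_apply] <;> ring

/-- A quadratic form that annihilates `(n, a × b)` also annihilates `(n, n)` when `n` is normal to
the plane spanned by `a` and `b`. -/
theorem dotProduct_mulVec_normal_eq_zero (C : Matrix (Fin 3) (Fin 3) ℝ) (a b n : Fin 3 → ℝ)
    (hab : LinearIndependent ℝ ![a, b]) (ha : n ⬝ᵥ a = 0) (hb : n ⬝ᵥ b = 0)
    (h : n ⬝ᵥ C *ᵥ crossProduct a b = 0) : n ⬝ᵥ C *ᵥ n = 0 := by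
  have hN : crossProduct a b ≠ 0 := crossProduct_ne_zero_iff_linearIndependent.2 hab
  set N := crossProduct a b with hNdef
  have hpar : (N ⬝ᵥ N) • n = (n ⬝ᵥ N) • N := by
    have h1 : crossProduct n N = 0 := by
      have e : crossProduct n N = (n ⬝ᵥ b) • a - (n ⬝ᵥ a) • b := by
        ext i
        fin_cases i <;>
          simp [hNdef, cross_apply, dotProduct, Fin.sum_univ_three] <;> ring
      rw [e, ha, hb]; simp
    have e : (N ⬝ᵥ N) • n - (n ⬝ᵥ N) • N = crossProduct N (crossProduct n N) := by
      ext i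
      fin_cases i <;> simp [cross_apply, dotProduct, Fin.sum_univ_three] <;> ring
    rw [h1, map_zero] at e
    exact sub_eq_zero.1 e
  have h2 : (N ⬝ᵥ N) * (n ⬝ᵥ C *ᵥ n) = 0 := by
    have := congrArg (fun v => n ⬝ᵥ C *ᵥ v) hpar
    simpa [mulVec_smul, h] using this
  exact (mul_eq_zero.1 h2).resolve_left (by simpa using hN)

theorem eq_zero_of_trace_smul_one_sub_eq_zero (S : Matrix (Fin 3) (Fin 3) ℝ)
    (h : S.trace • (1 : Matrix (Fin 3) (Fin 3) ℝ) - Sᵀ = 0) : S = 0 := by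
  have ht := congrArg Matrix.trace h
  have ht0 : S.trace = 0 := by
    simp at ht
    linarith
  simpa [ht0] using h

theorem exists_mulVec_eq_smul (V : Matrix (Fin 3) (Fin 3) ℝ) (d : Fin 3 → ℝ) (hd : d ≠ 0)
    (h : ∀ m : Fin 3 → ℝ, m ⬝ᵥ d = 0 → m ⬝ᵥ V *ᵥ d = 0) : ∃ l : ℝ, V *ᵥ d = l • d := by
  have hdd : d ⬝ᵥ d ≠ 0 := by simpa using hd
  refine ⟨(V *ᵥ d ⬝ᵥ d) / (d ⬝ᵥ d), sub_eq_zero.1 ?_⟩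
  set m := V *ᵥ d - ((V *ᵥ d ⬝ᵥ d) / (d ⬝ᵥ d)) • d with hm
  have hmd : m ⬝ᵥ d = 0 := by
    rw [hm, sub_dotProduct, smul_dotProduct, smul_eq_mul, div_mul_cancel₀ _ hdd, sub_self]
  have hmm : m ⬝ᵥ m = 0 := by
    conv_lhs => rw [hm, dotProduct_sub, ← hm]
    rw [h m hmd, dotProduct_smul, hmd]; simp
  simpa using hmm

/-- A trace-free matrix for which `d i` and all `d i - d j` are eigenvectors vanishes. -/
theorem eq_zero_of_eigenvectors (V : Matrix (Fin 3) (Fin 3) ℝ) (hV : V.trace = 0)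
    (d : Fin 3 → Fin 3 → ℝ) (hd : LinearIndependent ℝ d)
    (h1 : ∀ i, ∃ l : ℝ, V *ᵥ d i = l • d i)
    (h2 : ∀ i, i ≠ 0 → ∃ l : ℝ, V *ᵥ (d i - d 0) = l • (d i - d 0)) : V = 0 := by
  choose l hl using h1
  have heq : ∀ i, l i = l 0 := by
    intro i
    by_cases hi : i = 0
    · rw [hi]
    obtain ⟨μ, hμ⟩ := h2 i hi
    rw [mulVec_sub, hl, hl] at hμ
    have hpair : LinearIndependent ℝ ![d i, d 0] := by
      have := hd.comp ![i, 0] (by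
        intro x y; fin_cases x <;> fin_cases y <;> simp [hi, Ne.symm hi])
      convert this using 1
      ext x; fin_cases x <;> rfl
    obtain ⟨e1, e2⟩ := LinearIndependent.pair_iff.1 hpair (l i - μ) (μ - l 0) (by
      rw [← sub_eq_zero] at hμ; rw [← hμ]; module)
    linarith
  have hVl : V = l 0 • (1 : Matrix (Fin 3) (Fin 3) ℝ) := by
    apply (Matrix.toLin' (R := ℝ)).injective
    refine (basisOfLinearIndependentOfCardEqFinrank hd (by simp)).ext fun i => ?_
    simp [hl, heq i]
  have : l 0 = 0 := by
    rw [hVl] at hV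
    simpa using hV
  rw [hVl, this, zero_smul]

theorem AffineIndependent.linearIndependent_tov_sub {ι : Type*} {p : Fin 4 → E3}
    (hp : AffineIndependent ℝ p) (i : Fin 4) (f : ι → Fin 4) (hf : Function.Injective f)
    (hfi : ∀ k, f k ≠ i) : LinearIndependent ℝ fun k => tov (p (f k)) - tov (p i) := by
  have h := (affineIndependent_iff_linearIndependent_vsub ℝ p i).1 hp
  have h' := h.comp (fun k => (⟨f k, hfi k⟩ : {x // x ≠ i})) fun a b hab => hf (by simpa using hab)
  exact h'.map' (WithLp.linearEquiv 2 ℝ (Fin 3 → ℝ)).toLinearMap (LinearEquiv.ker _)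

/-- The vanishing tangential-normal moment on an edge, evaluated by the midpoint rule. -/
theorem edge_moment_midpoint (V S : Matrix (Fin 3) (Fin 3) ℝ) (a b m : E3) (hab : a ≠ b)
    (h : ∫ x in segment ℝ a b, tov m ⬝ᵥ
      (V + crossMat x S).mulVec (tov ((‖b - a‖⁻¹ : ℝ) • (b - a))) ∂μH[1] = 0) :
    tov m ⬝ᵥ (V *ᵥ (tov b - tov a) + crossProduct ((1 / 2 : ℝ) • (tov a + tov b))
      (S *ᵥ (tov b - tov a))) = 0 := by
  have hr : (‖b - a‖⁻¹ : ℝ) ≠ 0 := inv_ne_zero (norm_ne_zero_iff.2 (sub_ne_zero.2 hab.symm))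
  have hmul : ∀ x : E3, tov m ⬝ᵥ (V + crossMat x S).mulVec (tov ((‖b - a‖⁻¹ : ℝ) • (b - a))) =
      ‖b - a‖⁻¹ * (tov m ⬝ᵥ (V *ᵥ (tov b - tov a) +
        crossProduct (tov x) (S *ᵥ (tov b - tov a)))) := by
    intro x
    simp [crossMat, tov, cross_apply, Matrix.mulVec, dotProduct, Fin.sum_univ_three]
    ring
  simp only [hmul] at h
  refine (mul_eq_zero.1
    (eq_zero_of_setIntegral_segment_eq_zero a b hab _ ?_ _ ?_ h)).resolve_left hr
  · simp only [tov, cross_apply, dotProduct, Fin.sum_univ_three]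
    simp only [Pi.add_apply, cons_val_zero, cons_val_one, cons_val]
    fun_prop
  · intro x
    simp [tov, cross_apply, dotProduct, Fin.sum_univ_three]
    ring

/-- **Unisolvency of the degrees of freedom for the lowest-order `𝕋 ⊕ x×𝕊` element.**
If `u(x) = V + x × S` with `V` trace-free and `S` symmetric, the edge
tangential-normal moments (a) and the moments against the normal-normal bubbles (b)
all vanish, then `u = 0`. -/
theorem stmt0
    (p : Fin 4 → E3) (hp : AffineIndependent ℝ p)
    -- `n i` is a unit normal of the face of the tetrahedron opposite to vertex `p i`
    (n : Fin 4 → E3) (hn_unit : ∀ i, ‖n i‖ = 1)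
    (hn_normal : ∀ i j k : Fin 4, j ≠ i → k ≠ i → ⟪n i, p j - p k⟫ = 0)
    (V S : Matrix (Fin 3) (Fin 3) ℝ) (hV : V.trace = 0) (hS : S.IsSymm)
    (u : E3 → Matrix (Fin 3) (Fin 3) ℝ) (hu : ∀ x, u x = V + crossMat x S)
    -- (a): vanishing edge tangential-normal moments
    (hedge : ∀ i j : Fin 4, i < j → ∀ m : E3,
      ⟪m, (‖p j - p i‖⁻¹ : ℝ) • (p j - p i)⟫ = 0 →
      ∫ x in segment ℝ (p i) (p j),
        tov m ⬝ᵥ (u x).mulVec (tov ((‖p j - p i‖⁻¹ : ℝ) • (p j - p i))) ∂μH[1] = 0)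
    -- (b): vanishing moments against the normal-normal bubble space 𝔹_K
    (hbubble : ∀ b : Matrix (Fin 3) (Fin 3) ℝ, b.IsSymm →
      (∀ i, tov (n i) ⬝ᵥ b.mulVec (tov (n i)) = 0) →
      ∫ x in convexHull ℝ (Set.range p), ∑ i, ∑ j, mcurl u x i j * b i j = 0) :
    V = 0 ∧ S = 0 := by
  obtain rfl : u = fun x => V + crossMat x S := funext hu
  have hdot : ∀ x y : E3, ⟪x, y⟫ = tov x ⬝ᵥ tov y := fun x y => by
    rw [EuclideanSpace.inner_eq_star_dotProduct, dotProduct_comm]; rfl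
  have hlt : ∀ i j, i < j → ∀ m : Fin 3 → ℝ, m ⬝ᵥ (tov (p j) - tov (p i)) = 0 →
      m ⬝ᵥ (V *ᵥ (tov (p j) - tov (p i)) +
        crossProduct ((1 / 2 : ℝ) • (tov (p i) + tov (p j)))
          (S *ᵥ (tov (p j) - tov (p i)))) = 0 := by
    intro i j hij m hm
    refine edge_moment_midpoint V S (p i) (p j) (WithLp.toLp 2 m) (hp.injective.ne hij.ne)
      (hedge i j hij (WithLp.toLp 2 m) ?_)
    rw [inner_smul_right, hdot]
    exact mul_eq_zero_of_right _ hm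
  have hne : ∀ i j, i ≠ j → ∀ m : Fin 3 → ℝ, m ⬝ᵥ (tov (p j) - tov (p i)) = 0 →
      m ⬝ᵥ (V *ᵥ (tov (p j) - tov (p i)) +
        crossProduct ((1 / 2 : ℝ) • (tov (p i) + tov (p j)))
          (S *ᵥ (tov (p j) - tov (p i)))) = 0 := by
    intro i j hij m hm
    rcases lt_or_gt_of_ne hij with h | h
    · exact hlt i j h m hm
    · rw [← neg_sub, dotProduct_neg, neg_eq_zero] at hm
      have := hlt j i h m hm
      rw [← neg_sub (tov (p i)), mulVec_neg, mulVec_neg, map_neg, ← neg_add, dotProduct_neg,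
        neg_eq_zero, add_comm (tov (p i)) (tov (p j))]
      exact this
  set C := S.trace • (1 : Matrix (Fin 3) (Fin 3) ℝ) - Sᵀ with hC
  have hCsymm : C.IsSymm := by
    rw [hC, hS.eq]
    simp [Matrix.IsSymm, hS.eq]
  have hnn : ∀ i, tov (n i) ⬝ᵥ C *ᵥ tov (n i) = 0 := by
    intro i
    obtain ⟨j, k, l, hji, hki, hli, hjk, hjl, hkl⟩ : ∃ j k l : Fin 4,
        j ≠ i ∧ k ≠ i ∧ l ≠ i ∧ j ≠ k ∧ j ≠ l ∧ k ≠ l := by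
      revert i; decide
    have hn : ∀ a b, a ≠ i → b ≠ i → tov (n i) ⬝ᵥ (tov (p b) - tov (p a)) = 0 :=
      fun a b ha hb => (hdot _ _).symm.trans (hn_normal i b a hb ha)
    have hind : LinearIndependent ℝ ![tov (p k) - tov (p j), tov (p l) - tov (p j)] := by
      convert hp.linearIndependent_tov_sub j ![k, l]
        (by intro x y; fin_cases x <;> fin_cases y <;> simp [hkl, hkl.symm])
        (by intro x; fin_cases x <;> simp [hjk.symm, hjl.symm]) using 1
      ext x; fin_cases x <;> rfl
    refine dotProduct_mulVec_normal_eq_zero C _ _ _ hind (hn j k hji hki) (hn j l hji hli) ?_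
    rw [hC, ← cross_mulVec_sub]
    have e1 := hne j k hjk _ (hn j k hji hki)
    have e2 := hne k l hkl _ (hn k l hki hli)
    have e3 := hne j l hjl _ (hn j l hji hli)
    have key : crossProduct (tov (p k) - tov (p j)) (S *ᵥ (tov (p l) - tov (p j))) -
        crossProduct (tov (p l) - tov (p j)) (S *ᵥ (tov (p k) - tov (p j))) =
        (2 : ℝ) • ((V *ᵥ (tov (p k) - tov (p j)) +
          crossProduct ((1 / 2 : ℝ) • (tov (p j) + tov (p k))) (S *ᵥ (tov (p k) - tov (p j)))) +
        (V *ᵥ (tov (p l) - tov (p k)) +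
          crossProduct ((1 / 2 : ℝ) • (tov (p k) + tov (p l))) (S *ᵥ (tov (p l) - tov (p k)))) -
        (V *ᵥ (tov (p l) - tov (p j)) +
          crossProduct ((1 / 2 : ℝ) • (tov (p j) + tov (p l)))
            (S *ᵥ (tov (p l) - tov (p j))))) := by
      simp only [mulVec_sub, map_sub, map_add, map_smul, LinearMap.sub_apply, LinearMap.add_apply,
        LinearMap.smul_apply]
      module
    rw [key, dotProduct_smul, dotProduct_sub, dotProduct_add, e1, e2, e3]
    simp
  have hC0 : C = 0 := by
    have h := hbubble C hCsymm hnn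
    simp only [mcurl_add_crossMat, ← hC, integral_const, measureReal_restrict_apply_univ,
      smul_eq_mul] at h
    have hsum := (mul_eq_zero.1 h).resolve_left (volume_convexHull_range_pos p hp).ne'
    ext i j
    have h1 := (Finset.sum_eq_zero_iff_of_nonneg fun i _ =>
      Finset.sum_nonneg fun j _ => mul_self_nonneg (C i j)).1 hsum i (Finset.mem_univ i)
    have h2 := (Finset.sum_eq_zero_iff_of_nonneg fun j _ =>
      mul_self_nonneg (C i j)).1 h1 j (Finset.mem_univ j)
    exact mul_self_eq_zero.1 h2
  have hS0 : S = 0 := eq_zero_of_trace_smul_one_sub_eq_zero S hC0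
  refine ⟨?_, hS0⟩
  have heig : ∀ i j, i ≠ j → ∃ l : ℝ,
      V *ᵥ (tov (p j) - tov (p i)) = l • (tov (p j) - tov (p i)) := by
    intro i j hij
    refine exists_mulVec_eq_smul V _ ?_ fun m hm => by simpa [hS0] using hne i j hij m hm
    refine sub_ne_zero.2 fun h => hij (hp.injective ?_)
    exact (WithLp.ofLp_injective 2 h).symm
  refine eq_zero_of_eigenvectors V hV (fun k : Fin 3 => tov (p k.succ) - tov (p 0))
    (hp.linearIndependent_tov_sub 0 Fin.succ (Fin.succ_injective 3) Fin.succ_ne_zero)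
    (fun k => heig 0 k.succ (Fin.succ_ne_zero k).symm) fun k hk => ?_
  simpa using heig (Fin.succ 0) k.succ ((Fin.succ_injective 3).ne hk.symm)
end
end

section
/- Let p0, p1, p2, p3 ∈ ℝ³ be affinely independent points, and for i = 0,…,3 let n_i ∈ ℝ³ be a unit normal vector to the face of the tetrahedron opposite to p_i (the convex hull of the other three points). Then the four symmetric rank-one matrices n_i n_iᵀ (i = 0,…,3) are linearly independent in 𝕊; consequently the normal-normal bubble space 𝔹 = { b ∈ 𝕊 : n_iᵀ b n_i = 0 for i = 0,…,3 } has dimension 2. -/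
open Matrix
open scoped RealInnerProductSpace

noncomputable section

/-- If `x` is orthogonal to every edge of an affinely independent family of maximal size,
then `x = 0`. -/
lemma eq_zero_of_inner_sub_eq_zero {p : Fin 4 → E3} (hp : AffineIndependent ℝ p) {x : E3}
    (h : ∀ j k, ⟪x, p j - p k⟫ = 0) : x = 0 := by
  have htop : vectorSpan ℝ (Set.range p) = ⊤ :=
    hp.vectorSpan_eq_top_of_card_eq_finrank_add_one (by simp)
  have hle : vectorSpan ℝ (Set.range p) ≤ (ℝ ∙ x)ᗮ := by
    rw [vectorSpan, Submodule.span_le]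
    rintro _ ⟨_, ⟨j, rfl⟩, _, ⟨k, rfl⟩, rfl⟩
    exact Submodule.mem_orthogonal_singleton_iff_inner_right.2 (h j k)
  have hx : x ∈ (ℝ ∙ x)ᗮ := hle (htop ▸ Submodule.mem_top)
  exact inner_self_eq_zero.1 (Submodule.mem_orthogonal_singleton_iff_inner_right.1 hx)

/-- A face normal is not orthogonal to an edge that leaves the face. -/
lemma inner_normal_sub_ne_zero {p : Fin 4 → E3} (hp : AffineIndependent ℝ p) {x : E3}
    (hx : x ≠ 0) {a b : Fin 4} (hba : b ≠ a)
    (h : ∀ j k, j ≠ a → k ≠ a → ⟪x, p j - p k⟫ = 0) : ⟪x, p a - p b⟫ ≠ 0 := by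
  intro h0
  have hb : ∀ j, ⟪x, p j - p b⟫ = 0 := fun j => by
    rcases eq_or_ne j a with rfl | hj
    · exact h0
    · exact h j b hj hba
  refine hx (eq_zero_of_inner_sub_eq_zero hp fun j k => ?_)
  rw [← sub_sub_sub_cancel_right (p j) (p k) (p b), inner_sub_right, hb, hb, sub_zero]

lemma inner_eq_tov_dotProduct (x y : E3) : ⟪x, y⟫ = tov x ⬝ᵥ tov y := by
  rw [EuclideanSpace.inner_eq_star_dotProduct, dotProduct_comm]
  rfl

/-- The functionals `b ↦ nᵢᵀ b nᵢ` admit a dual family of symmetric matrices. -/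
lemma exists_isSymm_dual (p : Fin 4 → E3) (hp : AffineIndependent ℝ p)
    (n : Fin 4 → E3) (hn : ∀ i, n i ≠ 0)
    (hn_normal : ∀ i j k : Fin 4, j ≠ i → k ≠ i → ⟪n i, p j - p k⟫ = 0) (a : Fin 4) :
    ∃ w : Matrix (Fin 3) (Fin 3) ℝ, w.IsSymm ∧
      ∀ i, tov (n i) ⬝ᵥ w *ᵥ tov (n i) = if i = a then 1 else 0 := by
  obtain ⟨b, d, hb, hd, hbd⟩ : ∃ b d : Fin 4, b ≠ a ∧ d ≠ a ∧ b ≠ d := by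
    revert a; decide
  have hub := inner_normal_sub_ne_zero hp (hn a) hb (hn_normal a)
  have hud := inner_normal_sub_ne_zero hp (hn a) hd (hn_normal a)
  have hoff : ∀ i, i ≠ a → ⟪n i, p a - p b⟫ * ⟪n i, p a - p d⟫ = 0 := fun i hi => by
    rcases eq_or_ne i b with rfl | hib
    · rw [hn_normal i a d hi.symm hbd.symm, mul_zero]
    · rw [hn_normal i a b hi.symm hib.symm, zero_mul]
  set u := p a - p b
  set v := p a - p d
  refine ⟨(2 * (⟪n a, u⟫ * ⟪n a, v⟫))⁻¹ •
    (vecMulVec (tov u) (tov v) + vecMulVec (tov v) (tov u)), ?_, fun i => ?_⟩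
  · ext i j
    simp only [transpose_apply, Matrix.smul_apply, Matrix.add_apply, vecMulVec_apply, smul_eq_mul]
    ring
  · have hval : tov (n i) ⬝ᵥ ((2 * (⟪n a, u⟫ * ⟪n a, v⟫))⁻¹ •
        (vecMulVec (tov u) (tov v) + vecMulVec (tov v) (tov u))) *ᵥ tov (n i) =
        (2 * (⟪n a, u⟫ * ⟪n a, v⟫))⁻¹ * (2 * (⟪n i, u⟫ * ⟪n i, v⟫)) := by
      simp only [inner_eq_tov_dotProduct, smul_mulVec, add_mulVec, vecMulVec_mulVec,
        dotProduct_smul, dotProduct_add, smul_eq_mul, op_smul_eq_smul,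
        dotProduct_comm (tov u) (tov (n i)), dotProduct_comm (tov v) (tov (n i))]
      ring
    rw [hval]
    split_ifs with hi
    · subst hi
      exact inv_mul_cancel₀ (mul_ne_zero two_ne_zero (mul_ne_zero hub hud))
    · rw [hoff i hi, mul_zero, mul_zero]

/-- The quadratic form `b ↦ xᵀ b x` as a linear functional of the matrix `b`. -/
def quadEval (x : Fin 3 → ℝ) : Matrix (Fin 3) (Fin 3) ℝ →ₗ[ℝ] ℝ where
  toFun b := x ⬝ᵥ b *ᵥ x
  map_add' b c := by rw [add_mulVec, dotProduct_add]
  map_smul' r b := by rw [smul_mulVec, dotProduct_smul, RingHom.id_apply]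

/-- The three independent entries of the skew-symmetric part of a matrix, up to a factor `2`. -/
def skewEntries : Matrix (Fin 3) (Fin 3) ℝ →ₗ[ℝ] (Fin 3 → ℝ) where
  toFun b := ![b 0 1 - b 1 0, b 0 2 - b 2 0, b 1 2 - b 2 1]
  map_add' b c := by
    ext i; fin_cases i <;> simp <;> ring
  map_smul' r b := by
    ext i; fin_cases i <;> simp <;> ring

lemma skewEntries_eq_zero_iff (b : Matrix (Fin 3) (Fin 3) ℝ) :
    skewEntries b = 0 ↔ b.IsSymm := by
  constructor
  · intro h
    have h0 := congrFun h 0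
    have h1 := congrFun h 1
    have h2 := congrFun h 2
    simp only [skewEntries, LinearMap.coe_mk, AddHom.coe_mk, cons_val, Pi.zero_apply] at h0 h1 h2
    ext i j
    fin_cases i <;> fin_cases j <;> simp <;> linarith
  · intro h
    ext i
    fin_cases i <;> simp [skewEntries, h.apply 0 1, h.apply 0 2, h.apply 1 2]

lemma exists_skew (y : Fin 3 → ℝ) : ∃ k : Matrix (Fin 3) (Fin 3) ℝ,
    skewEntries k = y ∧ ∀ x, quadEval x k = 0 := by
  refine ⟨(2⁻¹ : ℝ) • !![0, y 0, y 1; -y 0, 0, y 2; -y 1, -y 2, 0], ?_, fun x => ?_⟩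
  · ext i
    fin_cases i <;> simp [skewEntries] <;> ring
  · simp [quadEval, dotProduct, mulVec, Fin.sum_univ_three]
    ring

/-- **Linear independence of the face normal-normal products, and the dimension of
the normal-normal bubble space.**  If `p 0, …, p 3` are affinely independent and
`n i` is a unit normal to the face opposite to `p i`, then the four rank-one
matrices `nᵢ nᵢᵀ` are linearly independent in the symmetric matrices, and the
bubble space `𝔹 = { b ∈ 𝕊 : nᵢᵀ b nᵢ = 0 for all i }` is a subspace of
dimension `2`. -/
theorem stmt1
    (p : Fin 4 → E3) (hp : AffineIndependent ℝ p)
    (n : Fin 4 → E3) (hn_unit : ∀ i, ‖n i‖ = 1)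
    (hn_normal : ∀ i j k : Fin 4, j ≠ i → k ≠ i → ⟪n i, p j - p k⟫ = 0) :
    LinearIndependent ℝ (fun i : Fin 4 => Matrix.vecMulVec (tov (n i)) (tov (n i)))
    ∧ ∃ B : Submodule ℝ (Matrix (Fin 3) (Fin 3) ℝ),
        (B : Set (Matrix (Fin 3) (Fin 3) ℝ))
          = {b | b.IsSymm ∧ ∀ i, tov (n i) ⬝ᵥ b.mulVec (tov (n i)) = 0}
        ∧ Module.finrank ℝ B = 2 := by
  have hn : ∀ i, n i ≠ 0 := fun i h => by simpa [h] using hn_unit i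
  choose w hw_symm hw using exists_isSymm_dual p hp n hn hn_normal
  constructor
  · let f : Fin 4 → Module.Dual ℝ (Matrix (Fin 3) (Fin 3) ℝ) := fun a =>
      traceLinearMap (Fin 3) ℝ ℝ ∘ₗ LinearMap.mulLeft ℝ (w a)
    have hf : ∀ a i, f a (vecMulVec (tov (n i)) (tov (n i))) = if i = a then 1 else 0 := by
      intro a i
      rw [← hw a i]
      simp [f, mul_vecMulVec, trace_vecMulVec, dotProduct_comm]
    refine LinearIndependent.of_pairwise_dual_eq_zero_one _ f (fun i j hij => ?_) fun i => ?_
    · simp [hf, hij.symm]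
    · simp [hf]
  · let L := (LinearMap.pi fun i => quadEval (tov (n i))).prod skewEntries
    have hL : Function.Surjective L := by
      rintro ⟨x, y⟩
      obtain ⟨k, hk, hk0⟩ := exists_skew y
      refine ⟨∑ a, x a • w a + k, Prod.ext (funext fun i => ?_) ?_⟩
      · have hq : ∀ a, quadEval (tov (n i)) (w a) = if i = a then 1 else 0 := fun a => hw a i
        simp [L, hk0, hq]
      · simp [L, hk, fun a => (skewEntries_eq_zero_iff _).2 (hw_symm a)]
    refine ⟨LinearMap.ker L, ?_, ?_⟩
    · ext b
      simp only [SetLike.mem_coe, LinearMap.mem_ker, L, LinearMap.prod_apply, Function.prod_apply,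
        Prod.mk_eq_zero, skewEntries_eq_zero_iff, Set.mem_ofPred_eq]
      rw [and_comm, funext_iff]
      rfl
    · have hrank := L.finrank_range_add_finrank_ker
      rw [LinearMap.range_eq_top.2 hL, finrank_top] at hrank
      simp [Module.finrank_matrix] at hrank
      omega
end
end

section
/- For every Σ ∈ ℝ^{3×3}, the row-wise curl of the matrix field u(x) = x × Σ is the constant matrix (tr Σ)·I − Σᵀ. In particular, if Σ ∈ 𝕊, then sym((curl u)(x)) = (tr Σ)·I − Σ for all x, and the linear map 𝕊 → 𝕊, Σ ↦ (tr Σ)·I − Σ, is bijective with inverse S ↦ (1/2)(tr S)·I − S. -/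
open Matrix

noncomputable section

/-- Symmetric part of a matrix. -/
def symm3 (A : Matrix (Fin 3) (Fin 3) ℝ) : Matrix (Fin 3) (Fin 3) ℝ := (2⁻¹ : ℝ) • (A + Aᵀ)

/-- The partial derivative of a linear functional is its value on the coordinate vector. -/
theorem pd_linearMap (k : Fin 3) (L : E3 →ₗ[ℝ] ℝ) (x : E3) :
    pd k L x = L (EuclideanSpace.single k 1) := by
  have h : HasFDerivAt L L.toContinuousLinearMap x := L.toContinuousLinearMap.hasFDerivAt
  rw [pd, h.fderiv]
  rfl

theorem pd_crossMat (k i l : Fin 3) (M : Matrix (Fin 3) (Fin 3) ℝ) (x : E3) :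
    pd k (fun y => crossMat y M i l) x = crossMat (EuclideanSpace.single k 1) M i l :=
  pd_linearMap k
    { toFun := fun y => crossMat y M i l
      map_add' := fun y z => by
        have h : tov (y + z) = tov y + tov z := rfl
        simp [crossMat, h]
      map_smul' := fun c y => by
        have h : tov (c • y) = c • tov y := rfl
        simp [crossMat, h] } x

theorem mcurl_crossMat (M : Matrix (Fin 3) (Fin 3) ℝ) (x : E3) :
    mcurl (fun y => crossMat y M) x
      = M.trace • (1 : Matrix (Fin 3) (Fin 3) ℝ) - Mᵀ := by
  ext i j
  simp only [mcurl, of_apply, pd_crossMat]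
  fin_cases i <;> fin_cases j <;>
    simp [crossMat, tov, eps, cross_apply, Fin.sum_univ_three, trace_fin_three] <;> ring

theorem isSymm_smul_one_sub {M : Matrix (Fin 3) (Fin 3) ℝ} (hM : M.IsSymm) (c : ℝ) :
    (c • (1 : Matrix (Fin 3) (Fin 3) ℝ) - M).IsSymm :=
  (isSymm_one.smul c).sub hM

theorem trace_smul_one_sub (M : Matrix (Fin 3) (Fin 3) ℝ) (c : ℝ) :
    (c • (1 : Matrix (Fin 3) (Fin 3) ℝ) - M).trace = 3 * c - M.trace := by
  simp [trace_sub, trace_smul, mul_comm]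

/-- **`curl (x × Σ) = (tr Σ)·I − Σᵀ`.**  For every `3×3` matrix `Σ`, the row-wise
curl of `x ↦ x × Σ` is the constant matrix `(tr Σ)·I − Σᵀ`.  If `Σ` is symmetric,
`sym curl (x × Σ) = (tr Σ)·I − Σ`, and the linear map `𝕊 → 𝕊`,
`Σ ↦ (tr Σ)·I − Σ`, is bijective (it maps 𝕊 to 𝕊) with inverse
`S ↦ (1/2)(tr S)·I − S`. -/
theorem stmt3 :
    (∀ (Sg : Matrix (Fin 3) (Fin 3) ℝ) (x : E3),
      mcurl (fun y => crossMat y Sg) x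
        = Sg.trace • (1 : Matrix (Fin 3) (Fin 3) ℝ) - Sgᵀ)
    ∧ (∀ Sg : Matrix (Fin 3) (Fin 3) ℝ, Sg.IsSymm → ∀ x : E3,
        symm3 (mcurl (fun y => crossMat y Sg) x)
          = Sg.trace • (1 : Matrix (Fin 3) (Fin 3) ℝ) - Sg)
    ∧ (∀ Sg : Matrix (Fin 3) (Fin 3) ℝ, Sg.IsSymm →
        (Sg.trace • (1 : Matrix (Fin 3) (Fin 3) ℝ) - Sg).IsSymm
        ∧ ((Sg.trace • (1 : Matrix (Fin 3) (Fin 3) ℝ) - Sg).trace / 2)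
            • (1 : Matrix (Fin 3) (Fin 3) ℝ)
            - (Sg.trace • (1 : Matrix (Fin 3) (Fin 3) ℝ) - Sg) = Sg)
    ∧ (∀ S : Matrix (Fin 3) (Fin 3) ℝ, S.IsSymm →
        ((S.trace / 2) • (1 : Matrix (Fin 3) (Fin 3) ℝ) - S).IsSymm
        ∧ ((S.trace / 2) • (1 : Matrix (Fin 3) (Fin 3) ℝ) - S).trace
            • (1 : Matrix (Fin 3) (Fin 3) ℝ)
            - ((S.trace / 2) • (1 : Matrix (Fin 3) (Fin 3) ℝ) - S) = S) := by
  refine ⟨mcurl_crossMat, fun M hM x => ?_, fun M hM => ⟨isSymm_smul_one_sub hM _, ?_⟩,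
    fun M hM => ⟨isSymm_smul_one_sub hM _, ?_⟩⟩
  · rw [mcurl_crossMat, hM.eq, symm3, (isSymm_smul_one_sub hM _).eq]
    module
  · rw [trace_smul_one_sub]
    module
  · rw [trace_smul_one_sub]
    module
end
end

section
/- Let Ω ⊆ ℝ³ be a nonempty connected open set, and let u : Ω → ℝ³ be twice continuously differentiable with dev(Du(x)) = 0 for every x ∈ Ω, where Du(x) denotes the Jacobian matrix of u at x. Then there exist a ∈ ℝ³ and b ∈ ℝ such that u(x) = a + b·x for all x ∈ Ω. -/
open Matrix

noncomputable section

/-- The Jacobian matrix of a map `u : ℝ³ → ℝ³`: `(jac u x) i j = ∂ⱼ uᵢ (x)`. -/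
def jac (u : E3 → E3) (x : E3) : Matrix (Fin 3) (Fin 3) ℝ :=
  Matrix.of fun i j => fderiv ℝ (fun y => u y i) x (EuclideanSpace.single j 1)

/-- Deviatoric (trace-free) part of a matrix. -/
def devm (A : Matrix (Fin 3) (Fin 3) ℝ) : Matrix (Fin 3) (Fin 3) ℝ :=
  A - (A.trace / 3) • (1 : Matrix (Fin 3) (Fin 3) ℝ)

/-- If the derivative of a `C²` map is a scalar multiple `p` of the identity near `x`, then, in
dimension at least two, the symmetry of the second derivative forces `p` to be stationary at `x`. -/
theorem fderiv_eq_zero_of_fderiv_eq_smul_id {E : Type*} [NormedAddCommGroup E] [NormedSpace ℝ E]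
    (hE : 1 < Module.rank ℝ E) {u : E → E} {p : E → ℝ} {x : E} (hu : ContDiffAt ℝ 2 u x)
    (hp : DifferentiableAt ℝ p x)
    (h : fderiv ℝ u =ᶠ[nhds x] fun y => p y • ContinuousLinearMap.id ℝ E) :
    fderiv ℝ p x = 0 := by
  have hsymm := hu.isSymmSndFDerivAt (by simp)
  have hsnd (v w : E) : fderiv ℝ (fderiv ℝ u) x v w = fderiv ℝ p x v • w := by
    rw [h.fderiv_eq, fderiv_smul_const hp]
    simp
  ext v
  by_cases hv : v = 0
  · simp [hv]
  obtain ⟨w, hvw⟩ := exists_linearIndependent_pair_of_one_lt_rank hE hv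
  have hlin : -fderiv ℝ p x w • v + fderiv ℝ p x v • w = 0 := by
    rw [← hsnd v w, hsymm v w, hsnd w v]
    simp
  exact (LinearIndependent.pair_iff.mp hvw _ _ hlin).2

/-- A map on `ℝ³` whose Jacobian has vanishing deviatoric part has a derivative that is a multiple
of the identity. -/
theorem fderiv_eq_smul_id_of_devm_jac_eq_zero {u : E3 → E3} {x : E3}
    (hu : DifferentiableAt ℝ u x) (h : devm (jac u x) = 0) :
    fderiv ℝ u x = ((jac u x).trace / 3) • ContinuousLinearMap.id ℝ E3 := by
  have hcoord (i j : Fin 3) :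
      jac u x i j = fderiv ℝ u x (EuclideanSpace.single j 1) i := by
    have hi : HasFDerivAt (fun y => u y i) ((EuclideanSpace.proj i).comp (fderiv ℝ u x)) x :=
      (EuclideanSpace.proj (𝕜 := ℝ) i).hasFDerivAt.comp x hu.hasFDerivAt
    simp [jac, hi.fderiv]
  have hjac : jac u x = ((jac u x).trace / 3) • (1 : Matrix (Fin 3) (Fin 3) ℝ) := sub_eq_zero.mp h
  refine ContinuousLinearMap.coe_injective
    ((EuclideanSpace.basisFun (Fin 3) ℝ).toBasis.ext fun j => ?_)
  ext i
  have hij := congrFun (congrFun hjac i) j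
  rw [hcoord] at hij
  simpa [Matrix.one_apply, Pi.single_apply] using hij

/-- The normalized divergence of a `C²` map is differentiable. -/
theorem differentiableAt_trace_jac {u : E3 → E3} {x : E3} (hu : ContDiffAt ℝ 2 u x) :
    DifferentiableAt ℝ (fun y => (jac u y).trace / 3) x := by
  have hcoord (i : Fin 3) : DifferentiableAt ℝ (fderiv ℝ fun y => u y i) x := by
    have hi : ContDiffAt ℝ 2 (fun y => u y i) x :=
      (EuclideanSpace.proj (𝕜 := ℝ) i).contDiff.contDiffAt.comp x hu
    exact (hi.fderiv_right (m := 1) (by norm_num)).differentiableAt (by simp)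
  have happly (i : Fin 3) : DifferentiableAt ℝ
      (fun y => fderiv ℝ (fun z => u z i) y (EuclideanSpace.single i 1)) x :=
    (hcoord i).clm_apply (differentiableAt_const _)
  simp only [Matrix.trace, jac, Matrix.diag_apply, Matrix.of_apply, div_eq_mul_inv]
  exact (DifferentiableAt.fun_sum fun i _ => happly i).mul_const _

/-- **`ker(dev grad)` consists of lowest-order Raviart–Thomas fields.**
If `Ω ⊆ ℝ³` is a nonempty connected open set and `u : Ω → ℝ³` is `C²` with
`dev(Du) = 0` on `Ω`, then `u(x) = a + b·x` on `Ω` for some `a ∈ ℝ³`, `b ∈ ℝ`. -/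
theorem stmt5 (Ω : Set E3) (hΩopen : IsOpen Ω) (hΩconn : IsConnected Ω)
    (u : E3 → E3) (hu : ContDiffOn ℝ 2 u Ω)
    (hdev : ∀ x ∈ Ω, devm (jac u x) = 0) :
    ∃ (a : E3) (b : ℝ), ∀ x ∈ Ω, u x = a + b • x := by
  have hC (x : E3) (hx : x ∈ Ω) : ContDiffAt ℝ 2 u x := hu.contDiffAt (hΩopen.mem_nhds hx)
  have hud (x : E3) (hx : x ∈ Ω) : DifferentiableAt ℝ u x :=
    (hC x hx).differentiableAt (by simp)
  have hfderiv (x : E3) (hx : x ∈ Ω) :=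
    fderiv_eq_smul_id_of_devm_jac_eq_zero (hud x hx) (hdev x hx)
  have hrank : 1 < Module.rank ℝ E3 := by
    rw [← Module.finrank_eq_rank, finrank_euclideanSpace_fin]
    norm_num
  obtain ⟨b, hb⟩ := hΩopen.exists_is_const_of_fderiv_eq_zero hΩconn.isPreconnected
    (fun x hx => (differentiableAt_trace_jac (hC x hx)).differentiableWithinAt)
    (fun x hx => fderiv_eq_zero_of_fderiv_eq_smul_id hrank (hC x hx)
      (differentiableAt_trace_jac (hC x hx))
      (Filter.eventuallyEq_of_mem (hΩopen.mem_nhds hx) hfderiv))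
  obtain ⟨a, ha⟩ := hΩopen.exists_eq_add_of_fderiv_eq hΩconn.isPreconnected
    (g := fun x => b • x) (fun x hx => (hud x hx).differentiableWithinAt)
    (differentiable_id.const_smul b).differentiableOn
    (fun x hx => by
      rw [hfderiv x hx, hb x hx, fderiv_fun_const_smul differentiableAt_fun_id, fderiv_fun_id])
  exact ⟨a, b, fun x hx => by rw [ha hx, add_comm]⟩
end
end

section
/- Let x1, x2, y1, y2 ∈ ℝ² be such that y1 and y2 lie strictly on opposite sides of the line through x1 and x2 (in particular x1 ≠ x2). Let T1 = conv{x1, x2, y1}, T2 = conv{x1, x2, y2}, e = [x1, x2] = T1 ∩ T2, and let n be the unit normal to e pointing from T1 to T2, i.e. n · (x2 − x1) = 0, ‖n‖ = 1, and n · (y2 − x1) > 0. Let u : T1 ∪ T2 → ℝ be continuous with u|_{T1} and u|_{T2} affine, and let g1, g2 ∈ ℝ² be the (constant) gradients of u on T1 and T2 respectively. Then for every smooth map φ : ℝ² → 𝕊₂ with compact support contained in the interior of T1 ∪ T2, ∫_{T1∪T2} u(x) · (div div φ)(x) dx = ((g2 − g1) · n) · ∫_e nᵀ φ(x) n dH¹(x),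 where div div φ = Σ_{i,j} ∂_i ∂_j φ_{ij} and the first integral is with respect to Lebesgue measure on ℝ². -/
open MeasureTheory Matrix
open scoped RealInnerProductSpace

noncomputable section

/-- Euclidean 2-space. -/
abbrev E2 := EuclideanSpace ℝ (Fin 2)

/-- View a Euclidean vector as a plain function `Fin 2 → ℝ`. -/
def tov2 (x : E2) : Fin 2 → ℝ := x

/-- Partial derivative in the `i`-th coordinate direction. -/
def pd2 (i : Fin 2) (f : E2 → ℝ) (x : E2) : ℝ := fderiv ℝ f x (EuclideanSpace.single i 1)

/-- `div div φ = ∑_{i,j} ∂_i ∂_j φ_{ij}`. -/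
def divdiv2 (φ : E2 → Matrix (Fin 2) (Fin 2) ℝ) (x : E2) : ℝ :=
  ∑ i, ∑ j, pd2 i (fun y => pd2 j (fun z => φ z i j) y) x

theorem isometry_add_smul_of_norm_eq_one (p v : E2) (hv : ‖v‖ = 1) :
    Isometry fun t : ℝ => p + t • v :=
  Isometry.of_dist_eq fun s t => by
    rw [dist_add_left, dist_eq_norm, ← sub_smul, norm_smul, hv, mul_one, Real.dist_eq,
      Real.norm_eq_abs]

theorem hasDerivAt_comp_add_smul {f : E2 → ℝ} (hf : Differentiable ℝ f) (p v : E2) (t : ℝ) :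
    HasDerivAt (fun t : ℝ => f (p + t • v)) (fderiv ℝ f (p + t • v) v) t := by
  have h : HasDerivAt (fun t : ℝ => p + t • v) v t := by
    simpa using ((hasDerivAt_id t).smul_const v).const_add p
  exact (hf _).hasFDerivAt.comp_hasDerivAt t h

theorem deriv_comp_add_smul {f : E2 → ℝ} (hf : Differentiable ℝ f) (p v : E2) :
    deriv (fun t : ℝ => f (p + t • v)) = fun t => fderiv ℝ f (p + t • v) v :=
  funext fun t => (hasDerivAt_comp_add_smul hf p v t).deriv

theorem exists_measurableEquiv_frame (b : OrthonormalBasis (Fin 2) ℝ E2) (p : E2) :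
    ∃ e : ℝ × ℝ ≃ᵐ E2, MeasurePreserving e volume volume ∧
      ∀ s t, e (s, t) = p + s • b 0 + t • b 1 := by
  let e : ℝ × ℝ ≃ᵐ E2 :=
    ((MeasurableEquiv.finTwoArrow.symm.trans (MeasurableEquiv.toLp 2 (Fin 2 → ℝ))).trans
      b.measurableEquiv.symm).trans (MeasurableEquiv.addLeft p)
  refine ⟨e, ?_, fun s t => ?_⟩
  · exact (measurePreserving_add_left volume p).comp
      (b.measurePreserving_measurableEquiv.symm.comp
        ((EuclideanSpace.volume_preserving_symm_measurableEquiv_toLp (Fin 2)).symm.comp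
          (volume_preserving_finTwoArrow ℝ).symm))
  · have h : e (s, t) = p + b.repr.symm !₂[s, t] := rfl
    rw [h, ← b.sum_repr_symm]
    simp [Fin.sum_univ_two, add_assoc]

theorem setIntegral_halfPlane (b : OrthonormalBasis (Fin 2) ℝ E2) (p : E2) {h : E2 → ℝ}
    (hh : Integrable h) :
    (∫ x in {x | 0 < ⟪b 1, x - p⟫}, h x =
        ∫ s : ℝ, ∫ t in Set.Ioi (0 : ℝ), h (p + s • b 0 + t • b 1)) ∧
      ∫ x in {x | 0 < ⟪b 1, x - p⟫}, h x =
        ∫ t in Set.Ioi (0 : ℝ), ∫ s : ℝ, h (p + s • b 0 + t • b 1) := by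
  obtain ⟨e, he, hef⟩ := exists_measurableEquiv_frame b p
  have hpre : e ⁻¹' {x | 0 < ⟪b 1, x - p⟫} = Set.univ ×ˢ Set.Ioi (0 : ℝ) := by
    ext ⟨s, t⟩
    have h01 : ⟪b 1, b 0⟫ = 0 := b.orthonormal.2 (by decide)
    simp [hef, add_sub_right_comm, inner_add_right, inner_smul_right, h01]
  have hint : Integrable (fun z => h (e z)) ((volume : Measure (ℝ × ℝ)).restrict
      (Set.univ ×ˢ Set.Ioi (0 : ℝ))) :=
    ((he.integrable_comp_emb e.measurableEmbedding).2 hh).restrict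
  rw [← he.setIntegral_preimage_emb e.measurableEmbedding, hpre]
  rw [Measure.volume_eq_prod, ← Measure.prod_restrict, Measure.restrict_univ] at hint ⊢
  constructor
  · rw [integral_prod _ hint]
    simp_rw [hef]
  · rw [integral_prod_symm _ hint]
    simp_rw [hef]

theorem setIntegral_halfPlane_fderiv (b : OrthonormalBasis (Fin 2) ℝ E2) (p w : E2) {f : E2 → ℝ}
    (hf : ContDiff ℝ 1 f) (hfc : HasCompactSupport f) :
    ∫ x in {x | 0 < ⟪b 1, x - p⟫}, fderiv ℝ f x w =
      -⟪b 1, w⟫ * ∫ t : ℝ, f (p + t • b 0) := by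
  have hd := hf.differentiable one_ne_zero
  have hint : ∀ v, Integrable fun x => fderiv ℝ f x v := fun v =>
    ((hf.continuous_fderiv one_ne_zero).clm_apply continuous_const).integrable_of_hasCompactSupport
      (hfc.fderiv_apply ℝ v)
  have hline : ∀ (q : E2) (i : Fin 2), ContDiff ℝ 1 (fun t : ℝ => f (q + t • b i)) ∧
      HasCompactSupport (fun t : ℝ => f (q + t • b i)) := fun q i =>
    ⟨hf.comp (contDiff_const.add (contDiff_id.smul contDiff_const)),
      hfc.comp_isClosedEmbedding
        (isometry_add_smul_of_norm_eq_one q (b i) (b.orthonormal.1 i)).isClosedEmbedding⟩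
  have hn : ∫ x in {x | 0 < ⟪b 1, x - p⟫}, fderiv ℝ f x (b 1) = -∫ t : ℝ, f (p + t • b 0) := by
    rw [(setIntegral_halfPlane b p (hint _)).1, ← integral_neg]
    congr with s
    have h := HasCompactSupport.integral_Ioi_deriv_eq (hline (p + s • b 0) 1).1
      (hline (p + s • b 0) 1).2 0
    rw [deriv_comp_add_smul hd] at h
    simpa using h
  have ht : ∫ x in {x | 0 < ⟪b 1, x - p⟫}, fderiv ℝ f x (b 0) = 0 := by
    rw [(setIntegral_halfPlane b p (hint _)).2]
    refine integral_eq_zero_of_ae (Filter.Eventually.of_forall fun t => ?_)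
    obtain ⟨h1, h2⟩ := hline (p + t • b 1) 0
    have h := integral_eq_zero_of_hasDerivAt_of_integrable
      (fun s => (hasDerivAt_comp_add_smul hd (p + t • b 1) (b 0) s))
      (by
        rw [← deriv_comp_add_smul hd]
        exact (h1.continuous_deriv le_rfl).integrable_of_hasCompactSupport h2.deriv)
      (h1.continuous.integrable_of_hasCompactSupport h2)
    simpa [add_right_comm] using h
  have hw : w = ⟪b 0, w⟫ • b 0 + ⟪b 1, w⟫ • b 1 := by
    simpa [Fin.sum_univ_two] using (b.sum_repr' w).symm
  have hfw : ∀ x, fderiv ℝ f x w =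
      ⟪b 0, w⟫ * fderiv ℝ f x (b 0) + ⟪b 1, w⟫ * fderiv ℝ f x (b 1) := fun x => by
    conv_lhs => rw [hw]
    simp
  simp_rw [hfw]
  rw [integral_add ((hint _).const_mul _).restrict ((hint _).const_mul _).restrict,
    integral_const_mul, integral_const_mul, hn, ht]
  ring

theorem integral_fderiv_apply_eq_zero {f : E2 → ℝ} (hf : ContDiff ℝ 1 f)
    (hfc : HasCompactSupport f) (v : E2) : ∫ x, fderiv ℝ f x v = 0 := by
  obtain ⟨C, hC⟩ := ContDiff.lipschitzWith_of_hasCompactSupport hfc hf one_ne_zero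
  have h := (LipschitzWith.const (α := E2) (1 : ℝ)).integral_lineDeriv_mul_eq
    (μ := volume) hC hfc (-v)
  simpa [(differentiableAt_const (1 : ℝ)).lineDeriv_eq_fderiv,
    (hf.differentiable one_ne_zero _).lineDeriv_eq_fderiv] using h.symm

theorem volume_setOf_inner_sub_eq_zero (n p : E2) (hn : n ≠ 0) :
    volume {x : E2 | ⟪n, x - p⟫ = 0} = 0 := by
  have h := Measure.addHaar_affineSubspace (volume : Measure E2)
    (AffineSubspace.mk' p (LinearMap.ker (innerSL ℝ n).toLinearMap)) fun htop => hn <| by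
      have hmem : p + n ∈ AffineSubspace.mk' p (LinearMap.ker (innerSL ℝ n).toLinearMap) := by
        rw [htop]; trivial
      simpa [AffineSubspace.mem_mk'] using hmem
  convert h using 2
  ext x
  simp [AffineSubspace.mem_mk']

/-- The continuous piecewise affine function with gradient `g` where `⟪n, x - p⟫ ≤ 0` and
`g + a • n` where `⟪n, x - p⟫ ≥ 0`. -/
def creasedAffine (c a : ℝ) (g n p x : E2) : ℝ := c + ⟪g, x⟫ + a * max ⟪n, x - p⟫ 0

theorem exists_lipschitzWith_creasedAffine (c a : ℝ) (g n p : E2) :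
    ∃ C, LipschitzWith C (creasedAffine c a g n p) := by
  have h1 : LipschitzWith _ fun x : E2 => c + ⟪g, x⟫ :=
    (LipschitzWith.const c).add (innerSL ℝ g).lipschitz
  have h2 : LipschitzWith _ fun x : E2 => ⟪n, x - p⟫ :=
    (innerSL ℝ n).lipschitz.comp (LipschitzWith.id.sub (LipschitzWith.const p))
  exact ⟨_, h1.add ((lipschitzWith_smul a).comp (h2.max_const 0))⟩

theorem lineDeriv_creasedAffine (c a : ℝ) (g n p v x : E2) (hx : ⟪n, x - p⟫ ≠ 0) :
    lineDeriv ℝ (creasedAffine c a g n p) x v =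
      ⟪g, v⟫ + {x | 0 < ⟪n, x - p⟫}.indicator (fun _ => a * ⟪n, v⟫) x := by
  have hcont : Continuous fun y : E2 => ⟪n, y - p⟫ := by fun_prop
  have hg : HasFDerivAt (fun y : E2 => c + ⟪g, y⟫) (innerSL ℝ g) x :=
    (innerSL ℝ g).hasFDerivAt.const_add c
  have hn : HasFDerivAt (fun y : E2 => ⟪n, y - p⟫) (innerSL ℝ n) x := by
    simp_rw [inner_sub_right]
    exact (innerSL ℝ n).hasFDerivAt.sub_const _
  rcases lt_or_gt_of_ne hx with h | h
  · have heq : creasedAffine c a g n p =ᶠ[nhds x] fun y => c + ⟪g, y⟫ := by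
      filter_upwards [hcont.continuousAt.eventually_lt continuousAt_const h] with y hy
      simp [creasedAffine, max_eq_right hy.le]
    rw [((hg.congr_of_eventuallyEq heq).hasLineDerivAt v).lineDeriv]
    simp [h.le]
  · have heq : creasedAffine c a g n p =ᶠ[nhds x] fun y => c + ⟪g, y⟫ + a * ⟪n, y - p⟫ := by
      filter_upwards [continuousAt_const.eventually_lt hcont.continuousAt h] with y hy
      simp [creasedAffine, max_eq_left hy.le]
    rw [(((hg.add (hn.const_mul a)).congr_of_eventuallyEq heq).hasLineDerivAt v).lineDeriv]
    simp [h]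

theorem integral_creasedAffine_mul_fderiv_fderiv (b : OrthonormalBasis (Fin 2) ℝ E2) (c a : ℝ)
    (g p v w : E2) {f : E2 → ℝ} (hf : ContDiff ℝ 2 f) (hfc : HasCompactSupport f) :
    ∫ x, creasedAffine c a g (b 1) p x * fderiv ℝ (fun y => fderiv ℝ f y w) x v =
      a * (⟪b 1, v⟫ * ⟪b 1, w⟫ * ∫ t : ℝ, f (p + t • b 0)) := by
  have hf' : ContDiff ℝ 1 fun y => fderiv ℝ f y w :=
    (hf.fderiv_right (m := 1) (by norm_num)).clm_apply contDiff_const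
  have hfc' : HasCompactSupport fun y => fderiv ℝ f y w := hfc.fderiv_apply ℝ w
  have hint : Integrable fun y => fderiv ℝ f y w :=
    hf'.continuous.integrable_of_hasCompactSupport hfc'
  have hf1 : ContDiff ℝ 1 f := hf.of_le (by norm_num)
  obtain ⟨C, hC⟩ := exists_lipschitzWith_creasedAffine c a g (b 1) p
  obtain ⟨D, hD⟩ := ContDiff.lipschitzWith_of_hasCompactSupport hfc' hf' one_ne_zero
  have hparts := hC.integral_lineDeriv_mul_eq (μ := volume) hD hfc' v
  simp_rw [(hf'.differentiable one_ne_zero _).lineDeriv_eq_fderiv, map_neg, neg_mul] at hparts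
  have hH : MeasurableSet {x : E2 | 0 < ⟪b 1, x - p⟫} :=
    measurableSet_lt measurable_const (by fun_prop)
  have hae : ∀ᵐ x : E2, lineDeriv ℝ (creasedAffine c a g (b 1) p) x v * fderiv ℝ f x w =
      ⟪g, v⟫ * fderiv ℝ f x w +
        {x | 0 < ⟪b 1, x - p⟫}.indicator (fun x => a * ⟪b 1, v⟫ * fderiv ℝ f x w) x := by
    have h0 : ∀ᵐ x : E2, ⟪b 1, x - p⟫ ≠ 0 := by
      rw [ae_iff]
      simpa using volume_setOf_inner_sub_eq_zero (b 1) p (b.orthonormal.ne_zero 1)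
    filter_upwards [h0] with x hx
    rw [lineDeriv_creasedAffine c a g (b 1) p v x hx, add_mul]
    by_cases h : 0 < ⟪b 1, x - p⟫ <;> simp [h]
  rw [integral_congr_ae hae, integral_add (hint.const_mul _) ((hint.const_mul _).indicator hH),
    integral_indicator hH, integral_const_mul, integral_const_mul,
    integral_fderiv_apply_eq_zero hf1 hfc, setIntegral_halfPlane_fderiv b p w hf1 hfc,
    integral_neg] at hparts
  simp_rw [mul_comm (creasedAffine _ _ _ _ _ _)]
  linarith

theorem exists_inner_eq_of_mem_triangle {n x1 x2 y x : E2} (horth : ⟪n, x2 - x1⟫ = 0)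
    (hx : x ∈ convexHull ℝ ({x1, x2, y} : Set E2)) :
    ∃ c : ℝ, 0 ≤ c ∧ ⟪n, x - x1⟫ = c * ⟪n, y - x1⟫ ∧ (c = 0 → x ∈ segment ℝ x1 x2) := by
  rw [← convexJoin_segment_singleton, mem_convexJoin] at hx
  obtain ⟨z, hz, _, rfl, α, c, hα, hc, hαc, rfl⟩ := hx
  refine ⟨c, hc, ?_, ?_⟩
  · have hzn : ⟪n, z - x1⟫ = 0 := by
      rw [segment_eq_image'] at hz
      obtain ⟨θ, -, rfl⟩ := hz
      simp [inner_smul_right, horth]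
    rw [inner_sub_right] at hzn ⊢
    rw [inner_add_right, inner_smul_right, inner_smul_right, inner_sub_right]
    linear_combination α * hzn + ⟪n, x1⟫ * hαc
  · rintro rfl
    obtain rfl : α = 1 := by simpa using hαc
    simpa using hz

theorem setIntegral_segment_hausdorffMeasure {x1 x2 v : E2} (hv : ‖v‖ = 1) {r : ℝ}
    (hseg : x2 - x1 = r • v) {h : E2 → ℝ}
    (hh : ∀ t : ℝ, x1 + t • v ∉ segment ℝ x1 x2 → h (x1 + t • v) = 0) :
    ∫ x in segment ℝ x1 x2, h x ∂μH[1] = ∫ t : ℝ, h (x1 + t • v) := by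
  have hiso := isometry_add_smul_of_norm_eq_one x1 v hv
  have hsub : segment ℝ x1 x2 ⊆ Set.range fun t : ℝ => x1 + t • v := by
    rw [segment_eq_image']
    rintro _ ⟨θ, -, rfl⟩
    exact ⟨θ * r, by simp [hseg, mul_smul]⟩
  rw [← hausdorffMeasure_real, ← hiso.isClosedEmbedding.measurableEmbedding.integral_map h,
    hiso.map_hausdorffMeasure (Or.inl zero_le_one)]
  refine (setIntegral_eq_of_subset_of_forall_sdiff_eq_zero
    hiso.isClosedEmbedding.isClosed_range.measurableSet hsub ?_).symm
  rintro _ ⟨⟨t, rfl⟩, ht⟩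
  exact hh t ht

theorem creasedAffine_eq_of_mem_triangle {x1 x2 y1 y2 n g1 g2 x : E2} {u : E2 → ℝ} {c1 c2 : ℝ}
    (b : OrthonormalBasis (Fin 2) ℝ E2) (hb1 : b 1 = n) {r : ℝ} (hr : r ≠ 0)
    (hseg : x2 - x1 = r • b 0) (horth : ⟪n, x2 - x1⟫ = 0)
    (hy1 : ⟪n, y1 - x1⟫ < 0) (hy2 : 0 < ⟪n, y2 - x1⟫)
    (hu1 : ∀ x ∈ convexHull ℝ ({x1, x2, y1} : Set E2), u x = c1 + ⟪g1, x⟫)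
    (hu2 : ∀ x ∈ convexHull ℝ ({x1, x2, y2} : Set E2), u x = c2 + ⟪g2, x⟫)
    (hx : x ∈ convexHull ℝ ({x1, x2, y1} : Set E2) ∪ convexHull ℝ ({x1, x2, y2} : Set E2)) :
    u x = creasedAffine c1 ⟪g2 - g1, n⟫ g1 n x1 x := by
  rcases hx with hx | hx
  · obtain ⟨c, hc, hcx, -⟩ := exists_inner_eq_of_mem_triangle horth hx
    have hle : ⟪n, x - x1⟫ ≤ 0 := hcx ▸ mul_nonpos_of_nonneg_of_nonpos hc hy1.le
    simp [creasedAffine, max_eq_right hle, hu1 x hx]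
  · obtain ⟨c, hc, hcx, -⟩ := exists_inner_eq_of_mem_triangle horth hx
    have hle : 0 ≤ ⟪n, x - x1⟫ := hcx ▸ mul_nonneg hc hy2.le
    have hmem : ∀ y : E2, ∀ z ∈ ({x1, x2} : Set E2), z ∈ convexHull ℝ ({x1, x2, y} : Set E2) :=
      fun y z hz => subset_convexHull ℝ _ (by
        rcases hz with rfl | rfl <;> simp)
    have e1 := (hu1 x1 (hmem y1 x1 (by simp))).symm.trans (hu2 x1 (hmem y2 x1 (by simp)))
    have e2 := (hu1 x2 (hmem y1 x2 (by simp))).symm.trans (hu2 x2 (hmem y2 x2 (by simp)))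
    have hτ : ⟪g2 - g1, b 0⟫ = 0 := by
      have h : r * ⟪g2 - g1, b 0⟫ = 0 := by
        rw [← inner_smul_right, ← hseg, inner_sub_left, inner_sub_right, inner_sub_right]
        linarith
      exact (mul_eq_zero.1 h).resolve_left hr
    have hpar : ⟪g2 - g1, x - x1⟫ = ⟪g2 - g1, n⟫ * ⟪n, x - x1⟫ := by
      have h := b.sum_inner_mul_inner (g2 - g1) (x - x1)
      rw [Fin.sum_univ_two, hτ, hb1] at h
      linarith
    rw [hu2 x hx, creasedAffine, max_eq_left hle, ← hpar, inner_sub_left, inner_sub_right,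
      inner_sub_right]
    linarith

theorem exists_orthonormalBasis_of_orthogonal {v n : E2} (hv : v ≠ 0) (hn : ‖n‖ = 1)
    (horth : ⟪n, v⟫ = 0) :
    ∃ b : OrthonormalBasis (Fin 2) ℝ E2, b 1 = n ∧ v = ‖v‖ • b 0 := by
  have hv' : ‖v‖ ≠ 0 := norm_ne_zero_iff.2 hv
  have hon : Orthonormal ℝ ![‖v‖⁻¹ • v, n] := by
    refine orthonormal_vecCons_iff.2 ⟨?_, fun i => ?_, ?_⟩
    · simp [norm_smul, hv']
    · simp [inner_smul_left, (real_inner_comm _ _).trans horth]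
    · refine orthonormal_vecCons_iff.2 ⟨hn, fun i => i.elim0, ?_⟩
      exact ⟨fun i => i.elim0, fun i => i.elim0⟩
  refine ⟨(basisOfOrthonormalOfCardEqFinrank hon (by simp)).toOrthonormalBasis (by simpa using hon),
    by simp, ?_⟩
  simp [smul_smul, hv']

/-- **Distributional Hessian of a continuous piecewise linear function
(two-triangle case, 2D).**  With `T1 = conv{x1,x2,y1}`, `T2 = conv{x1,x2,y2}`
sharing the edge `e = [x1,x2]` with unit normal `n` pointing from `T1` to `T2`,
and `u` continuous and affine on each triangle with gradients `g1`, `g2`, then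
for every smooth symmetric `φ` compactly supported in the interior of `T1 ∪ T2`:
`∫ u (div div φ) = ((g2 − g1)·n) ∫_e nᵀ φ n dH¹`. -/
theorem stmt10 (x1 x2 y1 y2 : E2) (hne : x1 ≠ x2)
    (nv : E2) (hn_orth : ⟪nv, x2 - x1⟫ = 0) (hn_unit : ‖nv‖ = 1)
    (hy1 : ⟪nv, y1 - x1⟫ < 0) (hy2 : 0 < ⟪nv, y2 - x1⟫)
    (u : E2 → ℝ) (g1 g2 : E2) (c1 c2 : ℝ)
    (hucont : ContinuousOn u
      (convexHull ℝ ({x1, x2, y1} : Set E2) ∪ convexHull ℝ ({x1, x2, y2} : Set E2)))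
    (hu1 : ∀ x ∈ convexHull ℝ ({x1, x2, y1} : Set E2), u x = c1 + ⟪g1, x⟫)
    (hu2 : ∀ x ∈ convexHull ℝ ({x1, x2, y2} : Set E2), u x = c2 + ⟪g2, x⟫)
    (φ : E2 → Matrix (Fin 2) (Fin 2) ℝ)
    (hφsmooth : ∀ i j, ContDiff ℝ (⊤ : ℕ∞) fun x => φ x i j)
    (hφsym : ∀ x, (φ x).IsSymm)
    (hφsupp : ∀ i j, tsupport (fun x => φ x i j) ⊆
      interior (convexHull ℝ ({x1, x2, y1} : Set E2) ∪ convexHull ℝ ({x1, x2, y2} : Set E2))) :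
    ∫ x in convexHull ℝ ({x1, x2, y1} : Set E2) ∪ convexHull ℝ ({x1, x2, y2} : Set E2),
        u x * divdiv2 φ x
      = ⟪g2 - g1, nv⟫
        * ∫ x in segment ℝ x1 x2, tov2 nv ⬝ᵥ (φ x).mulVec (tov2 nv) ∂μH[1] := by

  obtain ⟨b, hb1, hb0⟩ := exists_orthonormalBasis_of_orthogonal (sub_ne_zero.2 hne.symm)
    hn_unit hn_orth
  have hr : ‖x2 - x1‖ ≠ 0 := norm_ne_zero_iff.2 (sub_ne_zero.2 hne.symm)
  set K : Set E2 := convexHull ℝ ({x1, x2, y1} : Set E2) ∪ convexHull ℝ ({x1, x2, y2} : Set E2)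
   
  have hKc : IsCompact K :=
    ((Set.toFinite _).isCompact_convexHull ℝ).union
      ((Set.toFinite _).isCompact_convexHull ℝ)
  have hφ2 : ∀ i j, ContDiff ℝ 2 fun x => φ x i j := fun i j =>
    (hφsmooth i j).of_le (WithTop.coe_le_coe.2 (le_top : (2 : ℕ∞) ≤ ⊤))
  have hφc : ∀ i j, HasCompactSupport fun x => φ x i j := fun i j =>
    hKc.of_isClosed_subset (isClosed_tsupport _) ((hφsupp i j).trans interior_subset)
  have hφK : ∀ i j, ∀ x ∉ K, φ x i j = 0 := fun i j x hx =>
    image_eq_zero_of_notMem_tsupport (f := fun x => φ x i j)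
      fun h => hx (interior_subset (hφsupp i j h))
  have hdivK : ∀ x ∉ K, divdiv2 φ x = 0 := fun x hx =>
    Finset.sum_eq_zero fun i _ => Finset.sum_eq_zero fun j _ =>
      image_eq_zero_of_notMem_tsupport fun h => hx <| interior_subset <| hφsupp i j <|
        tsupport_fderiv_apply_subset ℝ _ <| tsupport_fderiv_apply_subset ℝ _ h
  have hline : ∀ t : ℝ, x1 + t • b 0 ∉ segment ℝ x1 x2 → x1 + t • b 0 ∉ K := by
    intro t ht hmem
    have h0 : ⟪nv, x1 + t • b 0 - x1⟫ = 0 := by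
      have h10 : ⟪b 1, b 0⟫ = 0 := b.orthonormal.2 (by decide)
      simp [inner_smul_right, ← hb1, h10]
    rcases hmem with hmem | hmem <;>
      obtain ⟨c, -, hcx, hc0⟩ := exists_inner_eq_of_mem_triangle hn_orth hmem
    · exact ht (hc0 ((mul_eq_zero.1 (hcx.symm.trans h0)).resolve_right hy1.ne))
    · exact ht (hc0 ((mul_eq_zero.1 (hcx.symm.trans h0)).resolve_right hy2.ne'))
  obtain ⟨C, hC⟩ := exists_lipschitzWith_creasedAffine c1 ⟪g2 - g1, nv⟫ g1 nv x1
  have hleft : ∫ x in K, u x * divdiv2 φ x =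
      ∑ i, ∑ j, ⟪g2 - g1, nv⟫ * (nv i * nv j * ∫ t : ℝ, φ (x1 + t • b 0) i j) := by
    have hint : ∀ i j, Integrable fun x => creasedAffine c1 ⟪g2 - g1, nv⟫ g1 nv x1 x *
        pd2 i (fun y => pd2 j (fun z => φ z i j) y) x := fun i j => by
      have h1 : ContDiff ℝ 1 fun y => pd2 j (fun z => φ z i j) y :=
        ((hφ2 i j).fderiv_right (m := 1) (by norm_num)).clm_apply contDiff_const
      have h2 : Continuous (pd2 i fun y => pd2 j (fun z => φ z i j) y) :=
        (h1.continuous_fderiv one_ne_zero).clm_apply continuous_const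
      exact (hC.continuous.mul h2).integrable_of_hasCompactSupport
        (HasCompactSupport.mul_left (((hφc i j).fderiv_apply ℝ _).fderiv_apply ℝ _))
    rw [setIntegral_congr_fun hKc.measurableSet fun x hx => by
        rw [creasedAffine_eq_of_mem_triangle b hb1 hr hb0 hn_orth hy1 hy2 hu1 hu2 hx],
      setIntegral_eq_integral_of_forall_compl_eq_zero fun x hx => by rw [hdivK x hx, mul_zero]]
    simp_rw [divdiv2, Finset.mul_sum]
    rw [integral_finsetSum _ fun i _ => integrable_finsetSum _ fun j _ => hint i j]
    refine Finset.sum_congr rfl fun i _ => ?_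
    rw [integral_finsetSum _ fun j _ => hint i j]
    refine Finset.sum_congr rfl fun j _ => ?_
    have h := integral_creasedAffine_mul_fderiv_fderiv b c1 ⟪g2 - g1, nv⟫ g1 x1
      (EuclideanSpace.single i 1) (EuclideanSpace.single j 1) (hφ2 i j) (hφc i j)
    rw [hb1] at h
    simpa [pd2, EuclideanSpace.inner_single_right] using h
  have hlineInt : ∀ i j, Integrable fun t : ℝ => φ (x1 + t • b 0) i j := fun i j =>
    have hcl := (isometry_add_smul_of_norm_eq_one x1 (b 0) (b.orthonormal.1 0)).isClosedEmbedding
    ((hφ2 i j).continuous.comp hcl.continuous).integrable_of_hasCompactSupport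
      ((hφc i j).comp_isClosedEmbedding hcl)
  have hright : ∫ x in segment ℝ x1 x2, tov2 nv ⬝ᵥ (φ x).mulVec (tov2 nv) ∂μH[1] =
      ∑ i, ∑ j, nv i * nv j * ∫ t : ℝ, φ (x1 + t • b 0) i j := by
    have hexp : ∀ x, tov2 nv ⬝ᵥ (φ x).mulVec (tov2 nv) = ∑ i, ∑ j, nv i * nv j * φ x i j :=
      fun x => by
        simp only [dotProduct, mulVec, tov2, Finset.mul_sum]
        exact Finset.sum_congr rfl fun i _ => Finset.sum_congr rfl fun j _ => by ring
    simp_rw [hexp]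
    rw [setIntegral_segment_hausdorffMeasure (b.orthonormal.1 0) hb0 fun t ht => by
        simp [hφK _ _ _ (hline t ht)],
      integral_finsetSum _ fun i _ => integrable_finsetSum _ fun j _ =>
        (hlineInt i j).const_mul _]
    refine Finset.sum_congr rfl fun i _ => ?_
    rw [integral_finsetSum _ fun j _ => (hlineInt i j).const_mul _]
    exact Finset.sum_congr rfl fun j _ => integral_const_mul _ _
  rw [hleft, hright]
  simp_rw [Finset.mul_sum]
end
end

section
/- Let x1, x2, y1, y2 ∈ ℝ² be such that y1 and y2 lie strictly on opposite sides of the line through x1 and x2. Let T1 = conv{x1, x2, y1}, T2 = conv{x1, x2, y2}, e = [x1, x2] = T1 ∩ T2, t = (x2 − x1)/‖x2 − x1‖, and let n be the unit normal to e pointing from T1 to T2 (n · t = 0, ‖n‖ = 1, n · (y2 − x1) > 0). Let σ1, σ2 ∈ 𝕊₂ be constant symmetric matrices with nᵀ σ1 n = nᵀ σ2 n, and let σ : T1 ∪ T2 → 𝕊₂ equal σ1 on the interior of T1 and σ2 on the interior of T2. Then for every smooth φ : ℝ² → ℝ with compact support contained in the interior of T1 ∪ T2, ∫_{T1∪T2}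 σ(x) : (∇²φ)(x) dx = (tᵀ (σ1 − σ2) n) · (φ(x2) − φ(x1)), where ∇²φ is the Hessian matrix of φ, : is the Frobenius inner product, and the integral is with respect to Lebesgue measure on ℝ². -/
open MeasureTheory Matrix
open scoped RealInnerProductSpace

noncomputable section

/-- The Hessian matrix of a scalar function: `(hess φ x) i j = ∂_i ∂_j φ (x)`. -/
def hess2 (φ : E2 → ℝ) (x : E2) : Matrix (Fin 2) (Fin 2) ℝ :=
  Matrix.of fun i j => pd2 i (fun y => pd2 j φ y) x

lemma contDiff_pd2 {φ : E2 → ℝ} (hφ : ContDiff ℝ (⊤ : ℕ∞) φ) (j : Fin 2) :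
    ContDiff ℝ (⊤ : ℕ∞) (pd2 j φ) := by
  unfold pd2
  exact (hφ.fderiv_right (m := (⊤ : ℕ∞)) (by simp)).clm_apply contDiff_const

lemma continuous_hess2 {φ : E2 → ℝ} (hφ : ContDiff ℝ (⊤ : ℕ∞) φ) (i j : Fin 2) :
    Continuous fun x => hess2 φ x i j :=
  (contDiff_pd2 (contDiff_pd2 hφ j) i).continuous

lemma hess2_comm {φ : E2 → ℝ} (hφ : ContDiff ℝ (⊤ : ℕ∞) φ) (x : E2) (i j : Fin 2) :
    hess2 φ x i j = hess2 φ x j i := by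
  have hd : DifferentiableAt ℝ (fderiv ℝ φ) x :=
    ((hφ.fderiv_right (m := (⊤ : ℕ∞)) (by simp)).differentiable (by simp)).differentiableAt
  have hs : IsSymmSndFDerivAt ℝ φ x :=
    hφ.contDiffAt.isSymmSndFDerivAt (by
      simpa using WithTop.coe_le_coe.2 (le_top : (2 : ℕ∞) ≤ ⊤))
  have key (k l : Fin 2) : hess2 φ x k l =
      fderiv ℝ (fderiv ℝ φ) x (EuclideanSpace.single k 1) (EuclideanSpace.single l 1) := by
    simp only [hess2, Matrix.of_apply, pd2]
    rw [fderiv_clm_apply hd (differentiableAt_const _)]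
    simp
  rw [key, key, hs.eq]

lemma tsupport_pd2_subset (φ : E2 → ℝ) (j : Fin 2) : tsupport (pd2 j φ) ⊆ tsupport φ :=
  tsupport_fderiv_apply_subset ℝ _

lemma hess2_eq_zero_of_notMem_tsupport {φ : E2 → ℝ} {x : E2} (hx : x ∉ tsupport φ)
    (i j : Fin 2) : hess2 φ x i j = 0 :=
  image_eq_zero_of_notMem_tsupport (f := pd2 i (pd2 j φ)) fun h =>
    hx (tsupport_pd2_subset φ j (tsupport_pd2_subset _ i h))

lemma integrable_hess2 {φ : E2 → ℝ} (hφ : ContDiff ℝ (⊤ : ℕ∞) φ) (hc : HasCompactSupport φ)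
    (i j : Fin 2) : Integrable fun x => hess2 φ x i j :=
  (continuous_hess2 hφ i j).integrable_of_hasCompactSupport <|
    HasCompactSupport.intro hc fun _ hx => hess2_eq_zero_of_notMem_tsupport hx i j

/-- The derivative in direction `w` of a compactly supported function integrates to zero over
every set that is invariant under translations along `w`. -/
lemma setIntegral_fderiv_apply_eq_zero {ψ : E2 → ℝ} (hψ : ContDiff ℝ 1 ψ)
    (hc : HasCompactSupport ψ) {S : Set E2} (hS : MeasurableSet S) {w : E2}
    (hw : ∀ (x : E2) (r : ℝ), x + r • w ∈ S ↔ x ∈ S) :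
    ∫ x in S, fderiv ℝ ψ x w = 0 := by
  have hint : Integrable ψ := hψ.continuous.integrable_of_hasCompactSupport hc
  have hint' : Integrable fun x => fderiv ℝ ψ x w :=
    ((hψ.continuous_fderiv (by simp)).clm_apply continuous_const).integrable_of_hasCompactSupport
      (hc.fderiv_apply ℝ w)
  have hmul (g : E2 → ℝ) : (fun x => ContinuousLinearMap.mul ℝ ℝ (S.indicator 1 x) (g x)) =
      S.indicator g := by
    ext x
    by_cases hx : x ∈ S <;> simp [hx]
  have key := integral_bilinear_hasLineDerivAt_right_eq_neg_left_of_integrable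
    (μ := (volume : Measure E2)) (f := S.indicator (1 : E2 → ℝ)) (f' := fun _ => (0 : ℝ))
    (g := ψ) (g' := fun x => fderiv ℝ ψ x w) (v := w) (B := ContinuousLinearMap.mul ℝ ℝ)
    (by simp)
    (by rw [hmul]; exact hint'.indicator hS) (by rw [hmul]; exact hint.indicator hS)
    (fun x _ => by
      have hconst : (fun r : ℝ => S.indicator (1 : E2 → ℝ) (x + r • w)) =
          fun _ => S.indicator (1 : E2 → ℝ) x := by
        ext r
        by_cases hx : x ∈ S
        · rw [Set.indicator_of_mem hx, Set.indicator_of_mem ((hw x r).2 hx)]; simp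
        · rw [Set.indicator_of_notMem hx, Set.indicator_of_notMem (mt (hw x r).1 hx)]
      unfold HasLineDerivAt
      rw [hconst]
      exact hasDerivAt_const _ _)
    (fun x _ => ((hψ.differentiable (by simp)) x).hasFDerivAt.hasLineDerivAt w)
  rw [hmul, integral_indicator hS] at key
  simpa using key

lemma fderiv_apply_eq_sum_pd2 (f : E2 → ℝ) (x w : E2) :
    fderiv ℝ f x w = ∑ i, w i * pd2 i f x := by
  have hw : w = ∑ i, w i • EuclideanSpace.single i (1 : ℝ) := by
    ext k
    fin_cases k <;> simp
  conv_lhs => rw [hw]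
  simp [pd2]

/-- The Hessian contracted with `w ⊗ c` integrates to zero over every set that is invariant
under translations along `w`. -/
lemma setIntegral_hess2_contract_eq_zero {φ : E2 → ℝ} (hφ : ContDiff ℝ (⊤ : ℕ∞) φ)
    (hc : HasCompactSupport φ) {S : Set E2} (hS : MeasurableSet S) {w : E2}
    (hw : ∀ (x : E2) (r : ℝ), x + r • w ∈ S ↔ x ∈ S) (c : Fin 2 → ℝ) :
    ∫ x in S, ∑ i, ∑ j, w i * c j * hess2 φ x i j = 0 := by
  have hsmooth : ContDiff ℝ 1 fun x => ∑ j, c j * pd2 j φ x :=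
    ContDiff.sum fun j _ => contDiff_const.mul ((contDiff_pd2 hφ j).of_le (by simp))
  have hsupp : HasCompactSupport fun x => ∑ j, c j * pd2 j φ x :=
    HasCompactSupport.intro hc fun x hx => Finset.sum_eq_zero fun j _ => by
      rw [image_eq_zero_of_notMem_tsupport fun h => hx (tsupport_pd2_subset φ j h), mul_zero]
  rw [← setIntegral_fderiv_apply_eq_zero hsmooth hsupp hS hw]
  congr 1 with x
  have hd (j : Fin 2) : DifferentiableAt ℝ (pd2 j φ) x :=
    ((contDiff_pd2 hφ j).differentiable (by simp)) x
  rw [fderiv_apply_eq_sum_pd2]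
  refine Finset.sum_congr rfl fun i _ => ?_
  rw [pd2, fderiv_fun_sum fun j _ => (hd j).const_mul (c j), _root_.sum_apply,
    Finset.mul_sum]
  refine Finset.sum_congr rfl fun j _ => ?_
  rw [fderiv_const_mul (hd j), mul_assoc]
  rfl

/-- A constant matrix field has vanishing distributional `div div`. -/
lemma integral_const_hess2_eq_zero {φ : E2 → ℝ} (hφ : ContDiff ℝ (⊤ : ℕ∞) φ)
    (hc : HasCompactSupport φ) (A : Matrix (Fin 2) (Fin 2) ℝ) :
    ∫ x, ∑ i, ∑ j, A i j * hess2 φ x i j = 0 := by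
  have hint (i : Fin 2) : Integrable fun x => ∑ j, A i j * hess2 φ x i j :=
    integrable_finsetSum _ fun j _ => (integrable_hess2 hφ hc i j).const_mul _
  rw [integral_finsetSum _ fun i _ => hint i]
  refine Finset.sum_eq_zero fun k _ => ?_
  have h := setIntegral_hess2_contract_eq_zero hφ hc MeasurableSet.univ
    (w := EuclideanSpace.single k 1) (by simp) (A k)
  rw [setIntegral_univ] at h
  rw [← h]
  congr 1 with x
  fin_cases k <;> simp

/-- A symmetric matrix whose normal-normal component vanishes, restricted to a half-plane with
normal `nv`, has vanishing distributional `div div`. -/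
lemma setIntegral_halfPlane_hess2_eq_zero {φ : E2 → ℝ} (hφ : ContDiff ℝ (⊤ : ℕ∞) φ)
    (hc : HasCompactSupport φ) {nv : E2} (hn : ‖nv‖ = 1) {A : Matrix (Fin 2) (Fin 2) ℝ}
    (hA : A.IsSymm) (hnn : tov2 nv ⬝ᵥ A.mulVec (tov2 nv) = 0) (a : ℝ) :
    ∫ x in {x : E2 | ⟪nv, x⟫ ≤ a}, ∑ i, ∑ j, A i j * hess2 φ x i j = 0 := by
  have hS : MeasurableSet {x : E2 | ⟪nv, x⟫ ≤ a} :=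
    (isClosed_le (by fun_prop) continuous_const).measurableSet
  set w : E2 := !₂[-nv 1, nv 0] with hw_def
  have hw : ⟪nv, w⟫ = 0 := by
    simp [hw_def, PiLp.inner_apply, Fin.sum_univ_two]; ring
  have hn2 : nv 0 ^ 2 + nv 1 ^ 2 = 1 := by
    have h := EuclideanSpace.real_norm_sq_eq nv
    rw [hn, Fin.sum_univ_two] at h
    linarith
  have hA10 : A 1 0 = A 0 1 := hA.apply 0 1
  have hnn' : nv 0 * (A 0 0 * nv 0 + A 0 1 * nv 1) + nv 1 * (A 0 1 * nv 0 + A 1 1 * nv 1) = 0 := by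
    simpa [dotProduct, Matrix.mulVec, Fin.sum_univ_two, tov2, hA10] using hnn
  set p : ℝ := w 0 * (A 0 0 * w 0 + A 0 1 * w 1) + w 1 * (A 0 1 * w 0 + A 1 1 * w 1) with hp
  set q : ℝ := nv 0 * (A 0 0 * w 0 + A 0 1 * w 1) + nv 1 * (A 0 1 * w 0 + A 1 1 * w 1) with hq
  rw [← setIntegral_hess2_contract_eq_zero hφ hc hS (w := w)
    (fun x r => by simp [inner_add_right, inner_smul_right, hw])
    (fun j => p * w j + 2 * q * nv j)]
  congr 1 with x
  have hH := hess2_comm hφ x 1 0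
  have hw0 : w 0 = -nv 1 := rfl
  have hw1 : w 1 = nv 0 := rfl
  have e00 : w 0 * (p * w 0 + 2 * q * nv 0) = A 0 0 := by
    rw [hp, hq, hw0, hw1]
    linear_combination A 0 0 * (nv 0 ^ 2 + nv 1 ^ 2 + 1) * hn2 - nv 0 ^ 2 * hnn'
  have e11 : w 1 * (p * w 1 + 2 * q * nv 1) = A 1 1 := by
    rw [hp, hq, hw0, hw1]
    linear_combination A 1 1 * (nv 0 ^ 2 + nv 1 ^ 2 + 1) * hn2 - nv 1 ^ 2 * hnn'
  have e01 : w 0 * (p * w 1 + 2 * q * nv 1) + w 1 * (p * w 0 + 2 * q * nv 0) = 2 * A 0 1 := by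
    rw [hp, hq, hw0, hw1]
    linear_combination 2 * A 0 1 * (nv 0 ^ 2 + nv 1 ^ 2 + 1) * hn2 - 2 * nv 0 * nv 1 * hnn'
  simp only [Fin.sum_univ_two, hA10, hH]
  linear_combination -(hess2 φ x 0 0) * e00 - hess2 φ x 1 1 * e11 - hess2 φ x 0 1 * e01

/-- A triangle lies in every half-plane that contains its vertices. -/
lemma convexHull_triple_subset_halfPlane {a b c : E2} (L : E2 →L[ℝ] ℝ) {r : ℝ} (ha : r ≤ L a)
    (hb : r ≤ L b) (hc : r ≤ L c) : convexHull ℝ {a, b, c} ⊆ {x | r ≤ L x} :=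
  convexHull_min (by rintro x (rfl | rfl | rfl) <;> assumption)
    (convex_halfSpace_ge L.toLinearMap.isLinear r)

/-- A point on the line of the edge `[x1, x2]`, beyond `x1`, lies outside the triangle. -/
lemma sub_smul_notMem_convexHull {x1 x2 y nv : E2} (hne : x1 ≠ x2)
    (horth : ⟪nv, x2 - x1⟫ = 0) (hy : ⟪nv, y - x1⟫ ≠ 0) {ε : ℝ} (hε : 0 < ε) :
    x1 - ε • (x2 - x1) ∉ convexHull ℝ ({x1, x2, y} : Set E2) := by
  intro h
  set k : ℝ := -⟪x2 - x1, y - x1⟫ / ⟪nv, y - x1⟫ with hk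
  have hpos : 0 < ⟪x2 - x1, x2 - x1⟫ := real_inner_self_pos.2 (sub_ne_zero.2 hne.symm)
  let L : E2 →L[ℝ] ℝ := innerSL ℝ (x2 - x1) + k • innerSL ℝ nv
  have hL (z : E2) : L z = L x1 + (⟪x2 - x1, z - x1⟫ + k * ⟪nv, z - x1⟫) := by
    simp only [L, _root_.add_apply, _root_.smul_apply, innerSL_apply_apply, smul_eq_mul,
      inner_sub_right]
    ring
  have hmem := convexHull_triple_subset_halfPlane L (r := L x1) le_rfl
    (by rw [hL x2, horth]; linarith)
    (by rw [hL y, hk, div_mul_cancel₀ _ hy]; linarith) h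
  have hsub : x1 - ε • (x2 - x1) - x1 = -(ε • (x2 - x1)) := by abel
  rw [Set.mem_ofPred_eq, hL (x1 - _), hsub, inner_neg_right, inner_neg_right, inner_smul_right,
    inner_smul_right, horth] at hmem
  nlinarith [mul_pos hε hpos]

/-- An endpoint of the common edge is not interior to the union of the two triangles. -/
lemma notMem_interior_union_convexHull {x1 x2 y1 y2 nv : E2} (hne : x1 ≠ x2)
    (horth : ⟪nv, x2 - x1⟫ = 0) (hy1 : ⟪nv, y1 - x1⟫ ≠ 0) (hy2 : ⟪nv, y2 - x1⟫ ≠ 0) :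
    x1 ∉ interior (convexHull ℝ ({x1, x2, y1} : Set E2) ∪ convexHull ℝ {x1, x2, y2}) := by
  intro h
  have hcont : Filter.Tendsto (fun ε : ℝ => x1 - ε • (x2 - x1)) (nhdsWithin 0 (Set.Ioi 0))
      (nhds x1) := by
    have hc : Continuous fun ε : ℝ => x1 - ε • (x2 - x1) := by fun_prop
    simpa using (hc.tendsto 0).mono_left nhdsWithin_le_nhds
  obtain ⟨ε, hmem, hε⟩ :=
    ((hcont.eventually (mem_interior_iff_mem_nhds.1 h)).and self_mem_nhdsWithin).exists
  exact hmem.elim (sub_smul_notMem_convexHull hne horth hy1 hε)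
    (sub_smul_notMem_convexHull hne horth hy2 hε)

/-- The interior of a triangle in a closed half-plane lies in the open half-plane. -/
lemma lt_of_mem_interior_convexHull_triple {a b c x : E2} {L : E2 →L[ℝ] ℝ} (hL0 : L ≠ 0) {r : ℝ}
    (ha : r ≤ L a) (hb : r ≤ L b) (hc : r ≤ L c)
    (hx : x ∈ interior (convexHull ℝ ({a, b, c} : Set E2))) : r < L x := by
  have hsurj : Function.Surjective L := by
    refine LinearMap.surjective (f := L.toLinearMap) fun h => hL0 ?_
    ext z
    exact congrArg (fun f => f z) h
  have h := (L.isOpenMap hsurj).interior_preimage_subset_preimage_interior (s := Set.Ici r)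
    (interior_mono (convexHull_triple_subset_halfPlane L ha hb hc) hx)
  simpa using h

/-- **Distributional `div div` of a piecewise constant symmetric matrix field with
continuous normal-normal component (two-triangle case, 2D; rotated Regge / HHJ).**
With `T1 = conv{x1,x2,y1}`, `T2 = conv{x1,x2,y2}` sharing the edge `e = [x1,x2]`
with unit tangent `t` and unit normal `n` pointing from `T1` to `T2`, and `σ` equal
to the constant symmetric matrices `σ1`, `σ2` on the interiors of `T1`, `T2` with
`nᵀσ1n = nᵀσ2n`, then for every smooth `φ` compactly supported in the interior of
`T1 ∪ T2`: `∫ σ : ∇²φ = (tᵀ(σ1 − σ2)n)(φ(x2) − φ(x1))`. -/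
theorem stmt12 (x1 x2 y1 y2 : E2) (hne : x1 ≠ x2)
    (nv : E2) (hn_orth : ⟪nv, x2 - x1⟫ = 0) (hn_unit : ‖nv‖ = 1)
    (hy1 : ⟪nv, y1 - x1⟫ < 0) (hy2 : 0 < ⟪nv, y2 - x1⟫)
    (σ1 σ2 : Matrix (Fin 2) (Fin 2) ℝ) (hσ1 : σ1.IsSymm) (hσ2 : σ2.IsSymm)
    (hnn : tov2 nv ⬝ᵥ σ1.mulVec (tov2 nv) = tov2 nv ⬝ᵥ σ2.mulVec (tov2 nv))
    (σ : E2 → Matrix (Fin 2) (Fin 2) ℝ)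
    (hσT1 : ∀ x ∈ interior (convexHull ℝ ({x1, x2, y1} : Set E2)), σ x = σ1)
    (hσT2 : ∀ x ∈ interior (convexHull ℝ ({x1, x2, y2} : Set E2)), σ x = σ2)
    (φ : E2 → ℝ) (hφsmooth : ContDiff ℝ (⊤ : ℕ∞) φ)
    (hφsupp : tsupport φ ⊆
      interior (convexHull ℝ ({x1, x2, y1} : Set E2) ∪ convexHull ℝ ({x1, x2, y2} : Set E2))) :
    ∫ x in convexHull ℝ ({x1, x2, y1} : Set E2) ∪ convexHull ℝ ({x1, x2, y2} : Set E2),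
        ∑ i, ∑ j, σ x i j * hess2 φ x i j
      = (tov2 ((‖x2 - x1‖⁻¹ : ℝ) • (x2 - x1)) ⬝ᵥ (σ1 - σ2).mulVec (tov2 nv))
          * (φ x2 - φ x1) := by
  set T1 := convexHull ℝ ({x1, x2, y1} : Set E2) with hT1
  set T2 := convexHull ℝ ({x1, x2, y2} : Set E2) with hT2
  have hT1c : IsCompact T1 := (Set.toFinite _).isCompact_convexHull ℝ
  have hT2c : IsCompact T2 := (Set.toFinite _).isCompact_convexHull ℝ
  have hc : HasCompactSupport φ := (hT1c.union hT2c).of_isClosed_subset (isClosed_tsupport φ)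
    (hφsupp.trans interior_subset)
  have hx2 : ⟪nv, x2⟫ = ⟪nv, x1⟫ := by rw [inner_sub_right] at hn_orth; linarith
  have hφ1 : φ x1 = 0 := image_eq_zero_of_notMem_tsupport fun h =>
    notMem_interior_union_convexHull hne hn_orth hy1.ne hy2.ne' (hφsupp h)
  have hφ2 : φ x2 = 0 := image_eq_zero_of_notMem_tsupport fun h => by
    have h' := hφsupp h
    rw [hT1, hT2, Set.insert_comm x1 x2, Set.insert_comm x1 x2] at h'
    rw [inner_sub_right, ← hx2, ← inner_sub_right] at hy1 hy2
    exact notMem_interior_union_convexHull hne.symm (by rw [inner_sub_right, hx2, sub_self])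
      hy1.ne hy2.ne' h'
  rw [hφ1, hφ2, sub_self, mul_zero]
  set S : Set E2 := {x | ⟪nv, x⟫ ≤ ⟪nv, x1⟫} with hS_def
  have hS : MeasurableSet S := (isClosed_le (by fun_prop) continuous_const).measurableSet
  have hnv : innerSL ℝ nv ≠ 0 := by
    intro h
    have := congrArg (fun L => L nv) h
    simp [hn_unit] at this
  rw [inner_sub_right] at hy1 hy2
  have hae : ∀ᵐ x ∂(volume : Measure E2), x ∈ T1 ∪ T2 →
      ∑ i, ∑ j, σ x i j * hess2 φ x i j = ∑ i, ∑ j, σ2 i j * hess2 φ x i j +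
        S.indicator (fun x => ∑ i, ∑ j, (σ1 - σ2) i j * hess2 φ x i j) x := by
    have hf1 : ∀ᵐ x ∂(volume : Measure E2), x ∉ frontier T1 :=
      measure_eq_zero_iff_ae_notMem.1 ((convex_convexHull ℝ _).addHaar_frontier volume)
    have hf2 : ∀ᵐ x ∂(volume : Measure E2), x ∉ frontier T2 :=
      measure_eq_zero_iff_ae_notMem.1 ((convex_convexHull ℝ _).addHaar_frontier volume)
    filter_upwards [hf1, hf2] with x h1 h2 hx
    rcases hx with hx | hx
    · have hxi : x ∈ interior T1 := by
        by_contra hni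
        exact h1 ⟨subset_closure hx, hni⟩
      have hxS : x ∈ S := by
        have := convexHull_triple_subset_halfPlane (-innerSL ℝ nv) (r := -⟪nv, x1⟫)
          (by simp) (by simp [hx2]) (by simp; linarith) hx
        simpa [hS_def] using this
      rw [Set.indicator_of_mem hxS, hσT1 x hxi]
      simp only [Matrix.sub_apply, sub_mul, Finset.sum_sub_distrib]
      ring
    · have hxi : x ∈ interior T2 := by
        by_contra hni
        exact h2 ⟨subset_closure hx, hni⟩
      have hxS : x ∉ S := by
        have := lt_of_mem_interior_convexHull_triple hnv (r := ⟪nv, x1⟫)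
          (by simp) (by simp [hx2]) (by simp; linarith) hxi
        simpa [hS_def] using this
      rw [Set.indicator_of_notMem hxS, hσT2 x hxi, add_zero]
  have hint (A : Matrix (Fin 2) (Fin 2) ℝ) :
      Integrable fun x => ∑ i, ∑ j, A i j * hess2 φ x i j :=
    integrable_finsetSum _ fun i _ => integrable_finsetSum _ fun j _ =>
      (integrable_hess2 hφsmooth hc i j).const_mul _
  rw [setIntegral_congr_ae (hT1c.union hT2c).measurableSet hae,
    setIntegral_eq_integral_of_forall_compl_eq_zero, integral_add (hint σ2)
      ((hint (σ1 - σ2)).indicator hS), integral_indicator hS,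
    integral_const_hess2_eq_zero hφsmooth hc, zero_add]
  · refine setIntegral_halfPlane_hess2_eq_zero hφsmooth hc hn_unit (hσ1.sub hσ2) ?_ _
    rw [Matrix.sub_mulVec, dotProduct_sub, hnn, sub_self]
  · intro x hx
    have hz := hess2_eq_zero_of_notMem_tsupport fun h => hx (interior_subset (hφsupp h))
    simp [hz]
end
end

section
/- Let x1 ≠ x2 ∈ ℝ², let e = [x1, x2] be the segment from x1 to x2, t = (x2 − x1)/‖x2 − x1‖, and n = t^⊥ = (−t2, t1). For a differentiable scalar function v : ℝ² → ℝ set curl v = (−∂₂v, ∂₁v); for a differentiable vector field w : ℝ² → ℝ² let curl w be the 2×2 matrix field whose i-th row is curl w_i, and div w = ∂₁w₁ + ∂₂w₂. Let p : ℝ² → ℝ be affine with (constant) gradient ∇p ∈ ℝ², and let w : ℝ² → ℝ² be twice continuously differentiable. Then ∫_e [ (curl w)(x) : sym(∇p ⊗ n) − (div(sym curl w)(x) · n) · p(x) ] dH¹(x) = (w·∇p − (1/2) p · div w)(x2) − (w·∇p − (1/2) p · div w)(x1), where sym A = (A + Aᵀ)/2, ⊗ is the outer product, : is the Frobenius inner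 product, and div of a matrix field is taken row-wise. -/
open MeasureTheory Matrix
open scoped RealInnerProductSpace

noncomputable section

/-- Row-wise curl of a 2D vector field: row `i` of `mcurl2 w` is
`curl wᵢ = (−∂₂wᵢ, ∂₁wᵢ)`. -/
def mcurl2 (w : E2 → E2) (x : E2) : Matrix (Fin 2) (Fin 2) ℝ :=
  Matrix.of fun i j =>
    (![-(pd2 1 (fun y => w y i) x), pd2 0 (fun y => w y i) x]) j

/-- Row-wise divergence of a matrix field: `(div M)ᵢ = ∑ₖ ∂ₖ Mᵢₖ`. -/
def divRow2 (M : E2 → Matrix (Fin 2) (Fin 2) ℝ) (x : E2) : Fin 2 → ℝ :=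
  fun i => ∑ k, pd2 k (fun y => M y i k) x

/-- Divergence of a 2D vector field. -/
def divv2 (w : E2 → E2) (x : E2) : ℝ := ∑ i, pd2 i (fun y => w y i) x

/-- Symmetric part of a 2×2 matrix. -/
def symm2 (A : Matrix (Fin 2) (Fin 2) ℝ) : Matrix (Fin 2) (Fin 2) ℝ := (2⁻¹ : ℝ) • (A + Aᵀ)

/-- Frobenius inner product of 2×2 matrices. -/
def frob2 (A B : Matrix (Fin 2) (Fin 2) ℝ) : ℝ := ∑ i, ∑ j, A i j * B i j

/-- The 1-dimensional Hausdorff integral over a segment, in arc-length parametrization. -/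
theorem setIntegral_segment_hausdorffMeasure_s13 {E : Type*} [NormedAddCommGroup E] [NormedSpace ℝ E]
    [MeasurableSpace E] [BorelSpace E] (x y t : E) (hxy : x ≠ y)
    (ht : t = (‖y - x‖⁻¹ : ℝ) • (y - x)) (f : E → ℝ) :
    ∫ z in segment ℝ x y, f z ∂μH[1] = ∫ s in (0 : ℝ)..‖y - x‖, f (x + s • t) := by
  have hL : 0 < ‖y - x‖ := norm_pos_iff.2 (sub_ne_zero.2 hxy.symm)
  have hnorm : ‖t‖ = 1 := by
    rw [ht, norm_smul, norm_inv, norm_norm, inv_mul_cancel₀ hL.ne']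
  have hγ : Isometry fun s : ℝ => x + s • t := Isometry.of_dist_eq fun a b => by
    rw [dist_add_left, dist_eq_norm, ← sub_smul, norm_smul, hnorm, mul_one, dist_eq_norm]
  have himage : segment ℝ x y = (fun s : ℝ => x + s • t) '' Set.Icc 0 ‖y - x‖ := by
    rw [segment_eq_image']
    ext z
    constructor
    · rintro ⟨θ, hθ, rfl⟩
      refine ⟨θ * ‖y - x‖, ⟨mul_nonneg hθ.1 hL.le, mul_le_of_le_one_left hL.le hθ.2⟩, ?_⟩
      simp only [ht, smul_smul, mul_assoc, mul_inv_cancel₀ hL.ne', mul_one]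
    · rintro ⟨s, hs, rfl⟩
      refine ⟨s * ‖y - x‖⁻¹, ⟨mul_nonneg hs.1 (inv_nonneg.2 hL.le), ?_⟩, ?_⟩
      · rw [← div_eq_mul_inv]
        exact div_le_one_of_le₀ hs.2 hL.le
      · simp only [ht, smul_smul]
  have hmap := hγ.map_hausdorffMeasure (d := 1) (Or.inl zero_le_one)
  have hemb : MeasurableEmbedding fun s : ℝ => x + s • t :=
    hγ.isClosedEmbedding.measurableEmbedding
  have hrestrict : (μH[1] : Measure E).restrict (segment ℝ x y)
      = ((volume : Measure ℝ).restrict (Set.Icc 0 ‖y - x‖)).map fun s => x + s • t := by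
    have hsub : segment ℝ x y ⊆ Set.range fun s : ℝ => x + s • t := by
      rw [himage]
      exact Set.image_subset_range _ _
    rw [← Measure.restrict_restrict_of_subset hsub, ← hmap, hausdorffMeasure_real,
      hemb.restrict_map, himage, hγ.injective.preimage_image]
  rw [hrestrict, hemb.integral_map, integral_Icc_eq_integral_Ioc,
    intervalIntegral.integral_of_le hL.le]

/-- The fundamental theorem of calculus along a segment. -/
theorem setIntegral_segment_fderiv {E : Type*} [NormedAddCommGroup E] [NormedSpace ℝ E]
    [MeasurableSpace E] [BorelSpace E] (x y t : E) (hxy : x ≠ y)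
    (ht : t = (‖y - x‖⁻¹ : ℝ) • (y - x)) (f : E → ℝ) (hf : ContDiff ℝ 1 f) :
    ∫ z in segment ℝ x y, fderiv ℝ f z t ∂μH[1] = f y - f x := by
  rw [setIntegral_segment_hausdorffMeasure_s13 x y t hxy ht]
  have hderiv : ∀ s : ℝ, HasDerivAt (fun s : ℝ => f (x + s • t)) (fderiv ℝ f (x + s • t) t) s := by
    intro s
    have hline : HasDerivAt (fun s : ℝ => x + s • t) t s := by
      simpa using ((hasDerivAt_id s).smul_const t).const_add x
    exact ((hf.differentiable one_ne_zero _).hasFDerivAt).comp_hasDerivAt s hline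
  have hcont : Continuous fun s : ℝ => fderiv ℝ f (x + s • t) t :=
    ((hf.continuous_fderiv one_ne_zero).comp (by fun_prop)).clm_apply continuous_const
  rw [intervalIntegral.integral_eq_sub_of_hasDerivAt (fun s _ => hderiv s)
    (hcont.intervalIntegrable _ _)]
  have hL : ‖y - x‖ ≠ 0 := norm_ne_zero_iff.2 (sub_ne_zero.2 hxy.symm)
  simp [ht, smul_smul, hL]

theorem fderiv_eq_pd2 (f : E2 → ℝ) (x v : E2) :
    fderiv ℝ f x v = v 0 * pd2 0 f x + v 1 * pd2 1 f x := by
  have hv : v = v 0 • EuclideanSpace.single 0 (1 : ℝ) + v 1 • EuclideanSpace.single 1 (1 : ℝ) := by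
    ext i
    fin_cases i <;> simp
  conv_lhs => rw [hv]
  simp [pd2]

theorem pd2_add {f g : E2 → ℝ} (hf : Differentiable ℝ f) (hg : Differentiable ℝ g) (k : Fin 2)
    (x : E2) : pd2 k (fun y => f y + g y) x = pd2 k f x + pd2 k g x := by
  simp [pd2, fderiv_fun_add (hf x) (hg x)]

theorem pd2_sub {f g : E2 → ℝ} (hf : Differentiable ℝ f) (hg : Differentiable ℝ g) (k : Fin 2)
    (x : E2) : pd2 k (fun y => f y - g y) x = pd2 k f x - pd2 k g x := by
  simp [pd2, fderiv_fun_sub (hf x) (hg x)]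

theorem pd2_neg (f : E2 → ℝ) (k : Fin 2) (x : E2) :
    pd2 k (fun y => -f y) x = -pd2 k f x := by
  simp [pd2, fderiv_fun_neg]

theorem pd2_mul {f g : E2 → ℝ} (hf : Differentiable ℝ f) (hg : Differentiable ℝ g) (k : Fin 2)
    (x : E2) : pd2 k (fun y => f y * g y) x = f x * pd2 k g x + g x * pd2 k f x := by
  simp [pd2, fderiv_fun_mul (hf x) (hg x)]

theorem pd2_const_mul {f : E2 → ℝ} (c : ℝ) (hf : Differentiable ℝ f) (k : Fin 2)
    (x : E2) : pd2 k (fun y => c * f y) x = c * pd2 k f x := by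
  simp [pd2, fderiv_const_mul (hf x)]

theorem pd2_const_add_inner (c : ℝ) (g : E2) (k : Fin 2) (x : E2) :
    pd2 k (fun y => c + ⟪g, y⟫) x = g k := by
  have h : HasFDerivAt (fun y : E2 => c + ⟪g, y⟫) (innerSL ℝ g) x :=
    (innerSL ℝ g).hasFDerivAt.const_add c
  simp [pd2, h.fderiv, EuclideanSpace.inner_single_right]

theorem contDiff_pd2_s13 {f : E2 → ℝ} (hf : ContDiff ℝ 2 f) (k : Fin 2) : ContDiff ℝ 1 (pd2 k f) :=
  (hf.fderiv_right (m := 1) (by norm_num)).clm_apply contDiff_const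

theorem pd2_comm {f : E2 → ℝ} (hf : ContDiff ℝ 2 f) (j k : Fin 2) (x : E2) :
    pd2 j (pd2 k f) x = pd2 k (pd2 j f) x := by
  have hd : DifferentiableAt ℝ (fderiv ℝ f) x :=
    (hf.fderiv_right (m := 1) (by norm_num)).differentiable one_ne_zero x
  have happly : ∀ i l : Fin 2, pd2 i (pd2 l f) x
      = fderiv ℝ (fderiv ℝ f) x (EuclideanSpace.single i 1) (EuclideanSpace.single l 1) := by
    intro i l
    have h := hd.hasFDerivAt.clm_apply
      (hasFDerivAt_const (EuclideanSpace.single l (1 : ℝ) : E2) x)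
    rw [pd2, show pd2 l f = fun y => fderiv ℝ f y (EuclideanSpace.single l 1) from rfl, h.fderiv]
    simp
  rw [happly, happly]
  exact (hf.contDiffAt.isSymmSndFDerivAt (by simp)).eq _ _

/-- **The edge integral identity behind the distributional `rot` of the edge
distributions `v̂¹_e[p]` in the auxiliary 2D Hessian complex.**  For an edge
`e = [x1,x2]` with unit tangent `t` and normal `n = t^⊥`, an affine `p` with
gradient `∇p`, and a `C²` vector field `w`:
`∫_e [ curl w : sym(∇p ⊗ n) − (div(sym curl w)·n)·p ] dH¹
  = (w·∇p − ½ p div w)(x2) − (w·∇p − ½ p div w)(x1)`. -/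
theorem stmt13 (x1 x2 : E2) (hne : x1 ≠ x2)
    (tv : E2) (htv : tv = (‖x2 - x1‖⁻¹ : ℝ) • (x2 - x1))
    (nv : E2) (hnv0 : tov2 nv 0 = -(tov2 tv 1)) (hnv1 : tov2 nv 1 = tov2 tv 0)
    (p : E2 → ℝ) (gp : E2) (cp : ℝ) (hp : ∀ x, p x = cp + ⟪gp, x⟫)
    (w : E2 → E2) (hw : ContDiff ℝ 2 w) :
    ∫ x in segment ℝ x1 x2,
        (frob2 (mcurl2 w x) (symm2 (Matrix.vecMulVec (tov2 gp) (tov2 nv)))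
          - (divRow2 (fun y => symm2 (mcurl2 w y)) x ⬝ᵥ tov2 nv) * p x) ∂μH[1]
      = (⟪w x2, gp⟫ - (1 / 2 : ℝ) * p x2 * divv2 w x2)
        - (⟪w x1, gp⟫ - (1 / 2 : ℝ) * p x1 * divv2 w x1) := by
  have ha : ContDiff ℝ 2 fun y => w y 0 := by fun_prop
  have hb : ContDiff ℝ 2 fun y => w y 1 := by fun_prop
  have hda : Differentiable ℝ fun y => w y 0 := ha.differentiable two_ne_zero
  have hdb : Differentiable ℝ fun y => w y 1 := hb.differentiable two_ne_zero
  have hca := contDiff_pd2_s13 ha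
  have hcb := contDiff_pd2_s13 hb
  have hdda : ∀ k, Differentiable ℝ (pd2 k fun y => w y 0) := fun k =>
    (hca k).differentiable one_ne_zero
  have hddb : ∀ k, Differentiable ℝ (pd2 k fun y => w y 1) := fun k =>
    (hcb k).differentiable one_ne_zero
  have hpeq : p = fun x => cp + ⟪gp, x⟫ := funext hp
  have hpc : ContDiff ℝ 1 p := by
    rw [hpeq]
    exact contDiff_const.add (contDiff_const.inner ℝ contDiff_id)
  have hpd : Differentiable ℝ p := hpc.differentiable one_ne_zero
  have hpp : ∀ k x, pd2 k p x = gp k := fun k x => by rw [hpeq, pd2_const_add_inner]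
  have hF : (fun y => ⟪w y, gp⟫ - (1 / 2 : ℝ) * p y * divv2 w y)
      = fun y => gp 0 * w y 0 + gp 1 * w y 1 - (1 / 2 : ℝ) *
        (p y * (pd2 0 (fun z => w z 0) y + pd2 1 (fun z => w z 1) y)) := by
    funext y
    simp [divv2, PiLp.inner_apply, Fin.sum_univ_two, mul_assoc]
  have hFc : ContDiff ℝ 1 fun y => ⟪w y, gp⟫ - (1 / 2 : ℝ) * p y * divv2 w y := by
    have ha1 : ContDiff ℝ 1 fun y => w y 0 := ha.of_le one_le_two
    have hb1 : ContDiff ℝ 1 fun y => w y 1 := hb.of_le one_le_two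
    rw [hF]
    exact ((contDiff_const.mul ha1).add (contDiff_const.mul hb1)).sub
      (contDiff_const.mul (hpc.mul ((hca 0).add (hcb 1))))
  rw [← setIntegral_segment_fderiv x1 x2 tv hne htv _ hFc]
  congr 1
  funext x
  have hdF : ∀ k, pd2 k (fun y => ⟪w y, gp⟫ - (1 / 2 : ℝ) * p y * divv2 w y) x
      = gp 0 * pd2 k (fun y => w y 0) x + gp 1 * pd2 k (fun y => w y 1) x - (1 / 2 : ℝ) *
        (p x * (pd2 k (pd2 0 fun z => w z 0) x + pd2 k (pd2 1 fun z => w z 1) x)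
          + (pd2 0 (fun z => w z 0) x + pd2 1 (fun z => w z 1) x) * gp k) := by
    intro k
    have hdiv := (hdda 0).fun_add (hddb 1)
    rw [hF, pd2_sub ((hda.const_mul _).fun_add (hdb.const_mul _)) ((hpd.fun_mul hdiv).const_mul _),
      pd2_add (hda.const_mul _) (hdb.const_mul _), pd2_const_mul _ hda, pd2_const_mul _ hdb,
      pd2_const_mul _ (hpd.fun_mul hdiv), pd2_mul hpd hdiv, pd2_add (hdda 0) (hddb 1), hpp]
  have hS : divRow2 (fun y => symm2 (mcurl2 w y)) x
      = ![-pd2 1 (pd2 0 fun z => w z 0) x / 2 - pd2 1 (pd2 1 fun z => w z 1) x / 2,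
        pd2 0 (pd2 0 fun z => w z 0) x / 2 + pd2 0 (pd2 1 fun z => w z 1) x / 2] := by
    have hd00 : ∀ k, pd2 k (fun y => symm2 (mcurl2 w y) 0 0) x
        = -pd2 k (pd2 1 fun z => w z 0) x := fun k => by
      rw [← pd2_neg]
      congr 1
      funext y
      simp [symm2, mcurl2]
      ring
    have hd11 : ∀ k, pd2 k (fun y => symm2 (mcurl2 w y) 1 1) x
        = pd2 k (pd2 0 fun z => w z 1) x := fun k => by
      congr 1
      funext y
      simp [symm2, mcurl2]
      ring
    have hoff : ∀ k, pd2 k (fun y => 2⁻¹ * (pd2 0 (fun z => w z 0) y - pd2 1 (fun z => w z 1) y)) x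
        = 2⁻¹ * (pd2 k (pd2 0 fun z => w z 0) x - pd2 k (pd2 1 fun z => w z 1) x) := fun k => by
      rw [pd2_const_mul _ ((hdda 0).fun_sub (hddb 1)), pd2_sub (hdda 0) (hddb 1)]
    have hd01 : ∀ k, pd2 k (fun y => symm2 (mcurl2 w y) 0 1) x
        = 2⁻¹ * (pd2 k (pd2 0 fun z => w z 0) x - pd2 k (pd2 1 fun z => w z 1) x) := fun k => by
      rw [← hoff]
      congr 1
    have hd10 : ∀ k, pd2 k (fun y => symm2 (mcurl2 w y) 1 0) x
        = 2⁻¹ * (pd2 k (pd2 0 fun z => w z 0) x - pd2 k (pd2 1 fun z => w z 1) x) := fun k => by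
      rw [← hoff]
      congr 1
      funext y
      simp [symm2, mcurl2]
      ring
    funext i
    fin_cases i
    · simp only [divRow2, Fin.sum_univ_two, Fin.zero_eta, hd00, hd01, pd2_comm ha 0 1]
      simp
      ring
    · simp only [divRow2, Fin.sum_univ_two, Fin.mk_one, hd10, hd11, pd2_comm hb 1 0]
      simp
      ring
  rw [fderiv_eq_pd2, hdF, hdF, hS]
  simp only [frob2, symm2, mcurl2, Fin.sum_univ_two, dotProduct, Matrix.vecMulVec_apply,
    Matrix.smul_apply, Matrix.add_apply, Matrix.transpose_apply, Matrix.of_apply, hnv0, hnv1,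
    Matrix.cons_val_zero, Matrix.cons_val_one, smul_eq_mul]
  simp only [tov2]
  ring
end
end
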